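/- arXiv:1502.01209 — 7 statements merged into one kernel-verified Lean document; each statement's English description precedes it below -/
import Mathlib

section
/- Let 0<α<1 and T>0. Let f:[0,T]→ℝ be continuous on [0,T], continuously differentiable on (0,T] with f' integrable on (0,T), and suppose f attains its maximum over [0,T] at a point t₀∈(0,T]. Then the Caputo fractional derivative of f at t₀ is nonnegative: D^α f(t₀) = (1/Γ(1-α)) ∫₀^{t₀} (t₀-τ)^{-α} f'(τ) dτ ≥ 0. -/
open MeasureTheory Set

/-- Caputo fractional derivative of order `α` with lower terminal `0`:
`D^α φ (t) = (1/Γ(1-α)) ∫₀ᵗ (t-τ)^(-α) φ'(τ) dτ`. -/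
noncomputable def caputoD (α : ℝ) (φ : ℝ → ℝ) (t : ℝ) : ℝ :=
  (1 / Real.Gamma (1 - α)) * ∫ τ in (0:ℝ)..t, (t - τ) ^ (-α) * deriv φ τ

/-- If `f` is differentiable at `b`, then `(b - s) ^ (-α) * (f s - f b)` tends
to `0` as `s` increases to `b`, for `α < 1`. -/
theorem tendsto_rpow_neg_mul_sub_nhdsLT {α b d : ℝ} {f : ℝ → ℝ} (hα : α < 1)
    (hf : HasDerivAt f d b) :
    Filter.Tendsto (fun s => (b - s) ^ (-α) * (f s - f b)) (nhdsWithin b (Iio b)) (nhds 0) := by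
  have hslope : Filter.Tendsto (slope f b) (nhdsWithin b (Iio b)) (nhds d) :=
    (hasDerivAt_iff_tendsto_slope_left_right.1 hf).1
  have hpow : Filter.Tendsto (fun s => (b - s) ^ (1 - α)) (nhdsWithin b (Iio b)) (nhds 0) := by
    have hc : Continuous fun s : ℝ => (b - s) ^ (1 - α) :=
      (continuous_const.sub continuous_id).rpow_const fun _ => Or.inr (by linarith)
    have := hc.tendsto b
    rw [sub_self, Real.zero_rpow (by linarith)] at this
    exact this.mono_left nhdsWithin_le_nhds
  have hmul := (hpow.mul hslope).neg
  rw [zero_mul, neg_zero] at hmul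
  refine hmul.congr' ?_
  filter_upwards [self_mem_nhdsWithin] with s hs
  have hpos : 0 < b - s := sub_pos.2 hs
  have hne : s - b ≠ 0 := by linarith
  rw [slope_def_field, sub_eq_add_neg 1 α, Real.rpow_add hpos, Real.rpow_one]
  field_simp
  ring

/-- Integration by parts against the kernel `(b - τ) ^ (-α)`, away from its singularity, for a
function bounded above by its value at `b`. -/
theorem rpow_neg_mul_sub_le_integral {α b s : ℝ} {f f' : ℝ → ℝ} (hα : 0 ≤ α)
    (hs : 0 ≤ s) (hsb : s < b) (hfc : ContinuousOn f (Icc 0 s))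
    (hfd : ∀ t ∈ Ioo 0 s, HasDerivAt f (f' t) t)
    (hint : IntervalIntegrable f' volume 0 s) (hmax : ∀ t ∈ Icc 0 s, f t ≤ f b) :
    (b - s) ^ (-α) * (f s - f b) ≤ ∫ τ in (0:ℝ)..s, (b - τ) ^ (-α) * f' τ := by
  have hne : ∀ x ∈ Icc 0 s, b - x ≠ 0 := fun x hx => by linarith [hx.2]
  have hcont : ∀ p : ℝ, ContinuousOn (fun x : ℝ => (b - x) ^ p) (Icc 0 s) := fun p =>
    (continuousOn_const.sub continuousOn_id).rpow_const fun x hx => Or.inl (hne x hx)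
  have hderiv : ∀ x ∈ Icc 0 s,
      HasDerivAt (fun x : ℝ => (b - x) ^ (-α)) (α * (b - x) ^ (-α - 1)) x := fun x hx => by
    convert ((hasDerivAt_id' x).const_sub b).rpow_const (p := -α) (Or.inl (hne x hx)) using 1
    ring
  have hparts := intervalIntegral.integral_mul_deriv_eq_deriv_mul_of_hasDerivAt
    (a := 0) (b := s) (u := fun x : ℝ => (b - x) ^ (-α)) (u' := fun x => α * (b - x) ^ (-α - 1))
    (v := fun x => f x - f b) (v' := f')
    (by rw [uIcc_of_le hs]; exact hcont _)
    (by rw [uIcc_of_le hs]; exact hfc.sub continuousOn_const)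
    (by rw [min_eq_left hs, max_eq_right hs]; exact fun x hx => hderiv x (Ioo_subset_Icc_self hx))
    (by rw [min_eq_left hs, max_eq_right hs]; exact fun x hx => (hfd x hx).sub_const _)
    (by
      apply ContinuousOn.intervalIntegrable
      rw [uIcc_of_le hs]
      exact continuousOn_const.mul (hcont _))
    hint
  have hrest : 0 ≤ ∫ x in (0:ℝ)..s, -(α * (b - x) ^ (-α - 1) * (f x - f b)) := by
    refine intervalIntegral.integral_nonneg hs fun x hx => ?_
    have hk : 0 ≤ (b - x) ^ (-α - 1) := Real.rpow_nonneg (by linarith [hx.2]) _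
    have := mul_nonneg (mul_nonneg hα hk) (sub_nonneg.2 (hmax x hx))
    linarith
  rw [intervalIntegral.integral_neg] at hrest
  have hzero : 0 ≤ (b - 0) ^ (-α) * (f b - f 0) :=
    mul_nonneg (Real.rpow_nonneg (by linarith) _) (sub_nonneg.2 (hmax 0 ⟨le_rfl, hs⟩))
  rw [hparts]
  linarith

/-- Extremum principle for the Caputo derivative: if `f` attains its maximum over `[0,T]`
at `t₀ ∈ (0,T]`, then `D^α f (t₀) ≥ 0`. -/
theorem caputo_nonneg_at_max (α T : ℝ) (hα0 : 0 < α) (hα1 : α < 1) (hT : 0 < T)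
    (f : ℝ → ℝ)
    (hfc : ContinuousOn f (Icc 0 T))
    (hfd : ∀ t ∈ Ioc (0:ℝ) T, DifferentiableAt ℝ f t)
    (hfd' : ContinuousOn (deriv f) (Ioc 0 T))
    (hfint : IntegrableOn (deriv f) (Ioc 0 T))
    (t₀ : ℝ) (ht₀ : t₀ ∈ Ioc (0:ℝ) T)
    (hmax : ∀ t ∈ Icc (0:ℝ) T, f t ≤ f t₀) :
    0 ≤ caputoD α f t₀ := by
  obtain ⟨hpos, hle⟩ := ht₀
  refine mul_nonneg (one_div_nonneg.2 (Real.Gamma_pos_of_pos (by linarith)).le) ?_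
  by_cases hI : IntervalIntegrable (fun τ => (t₀ - τ) ^ (-α) * deriv f τ) volume 0 t₀
  · have hprim : Filter.Tendsto (fun s => ∫ τ in (0:ℝ)..s, (t₀ - τ) ^ (-α) * deriv f τ)
        (nhdsWithin t₀ (Iio t₀)) (nhds (∫ τ in (0:ℝ)..t₀, (t₀ - τ) ^ (-α) * deriv f τ)) := by
      have hc := intervalIntegral.continuousOn_primitive_interval' hI left_mem_uIcc t₀
        right_mem_uIcc
      rw [uIcc_of_le hpos.le] at hc
      rw [← nhdsWithin_Ico_eq_nhdsLT hpos]
      exact hc.mono_left (nhdsWithin_mono _ Ico_subset_Icc_self)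
    refine le_of_tendsto_of_tendsto
      (tendsto_rpow_neg_mul_sub_nhdsLT hα1 (hfd t₀ ⟨hpos, hle⟩).hasDerivAt) hprim ?_
    filter_upwards [Ico_mem_nhdsLT hpos] with s hs
    have hsT : s ≤ T := hs.2.le.trans hle
    refine rpow_neg_mul_sub_le_integral hα0.le hs.1 hs.2 (hfc.mono (Icc_subset_Icc_right hsT))
      (fun t ht => (hfd t ⟨ht.1, ht.2.le.trans hsT⟩).hasDerivAt) ?_
      (fun t ht => hmax t ⟨ht.1, ht.2.trans hsT⟩)
    rw [intervalIntegrable_iff_integrableOn_Ioc_of_le hs.1]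
    exact hfint.mono_set (Ioc_subset_Ioc_right hsT)
  · rw [intervalIntegral.integral_undef hI]
end

section
/- Let 0<α<1 and t₀>0. Let h:[0,t₀]→ℝ be continuous on [0,t₀], continuously differentiable on (0,t₀] with h' integrable on (0,t₀), and suppose h(t)≤0 for all t∈[0,t₀], h(0)<0, and h(t₀)=0 (so h attains its maximum at t₀). Then D^α h(t₀) ≥ (h(t₀)-h(0))/(t₀^α Γ(1-α)) = -h(0)/(t₀^α Γ(1-α)) > 0. -/
open MeasureTheory Set

/-- The weight `(t₀ - τ)^(-α)` times a function that is integrable on `(0,t₀)` and continuous on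
`(0,t₀]` is integrable on `(0,t₀)`. -/
theorem intervalIntegrable_sub_rpow_neg_mul {α t₀ : ℝ} (hα1 : α < 1) (ht₀ : 0 < t₀) {g : ℝ → ℝ}
    (hgc : ContinuousOn g (Ioc 0 t₀)) (hgi : IntegrableOn g (Ioc 0 t₀)) :
    IntervalIntegrable (fun τ => (t₀ - τ) ^ (-α) * g τ) volume 0 t₀ := by
  have hg : IntervalIntegrable g volume 0 t₀ :=
    (intervalIntegrable_iff_integrableOn_Ioc_of_le ht₀.le).2 hgi
  have hhalf : t₀ / 2 ≤ t₀ := by linarith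
  have hleft : IntervalIntegrable (fun τ => (t₀ - τ) ^ (-α) * g τ) volume 0 (t₀ / 2) := by
    refine IntervalIntegrable.continuousOn_mul (hg.mono_set ?_) ?_
    · rw [uIcc_of_le (by positivity), uIcc_of_le ht₀.le]
      exact Icc_subset_Icc_right hhalf
    · rw [uIcc_of_le (by positivity)]
      exact ContinuousOn.rpow_const (by fun_prop) fun τ hτ => Or.inl (by linarith [hτ.2])
  have hright : IntervalIntegrable (fun τ => (t₀ - τ) ^ (-α) * g τ) volume (t₀ / 2) t₀ := by
    refine IntervalIntegrable.mul_continuousOn ?_ ?_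
    · have := (intervalIntegral.intervalIntegrable_rpow' (a := t₀ / 2) (b := 0)
        (r := -α) (by linarith)).comp_sub_left t₀
      simpa [sub_half] using this
    · rw [uIcc_of_le hhalf]
      exact hgc.mono fun τ hτ => ⟨by linarith [hτ.1], hτ.2⟩
  exact hleft.trans hright

/-- If `h` is continuous on `[0,t₀]`, differentiable at `t₀` and vanishes there, then
`(t₀ - s)^(-α) h(s)` is continuous on `[0,t₀]` for `α < 1`. -/
theorem continuousOn_sub_rpow_neg_mul {α t₀ : ℝ} (hα1 : α < 1) {h : ℝ → ℝ}
    (hhc : ContinuousOn h (Icc 0 t₀)) (hhd : DifferentiableAt ℝ h t₀) (hzero : h t₀ = 0) :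
    ContinuousOn (fun s => (t₀ - s) ^ (-α) * h s) (Icc 0 t₀) := by
  intro s hs
  rcases hs.2.lt_or_eq with hlt | rfl
  · exact (ContinuousWithinAt.rpow_const (by fun_prop) (Or.inl (by linarith))).mul (hhc s hs)
  · have hcont : ContinuousAt (fun x => -((s - x) ^ (1 - α) * dslope h s x)) s := by
      refine ((ContinuousAt.rpow_const (by fun_prop) (Or.inr (by linarith))).mul ?_).neg
      exact continuousAt_dslope_same.2 hhd
    have heq : ∀ x ∈ Icc 0 s, (s - x) ^ (-α) * h x = -((s - x) ^ (1 - α) * dslope h s x) := by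
      intro x hx
      rcases hx.2.lt_or_eq with hlt | rfl
      · have hpos : 0 < s - x := by linarith
        have hsub : x - s ≠ 0 := by linarith
        rw [dslope_of_ne _ hlt.ne, slope_def_field, hzero, sub_eq_add_neg 1 α,
          Real.rpow_add hpos, Real.rpow_one]
        field_simp
        ring
      · simp [hzero, Real.zero_rpow (sub_ne_zero.2 hα1.ne')]
    exact hcont.continuousWithinAt.congr heq (heq s hs)

/-- The boundary term of the integration by parts bounds the weighted integral of `h'` from below
when `h ≤ 0` on `[0,t₀]` and `h t₀ = 0`. -/
theorem neg_mul_rpow_le_integral_sub_rpow_mul_deriv {α t₀ : ℝ} (hα0 : 0 < α) (hα1 : α < 1)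
    (ht₀ : 0 < t₀) {h : ℝ → ℝ}
    (hhc : ContinuousOn h (Icc 0 t₀))
    (hhd : ∀ t ∈ Ioc (0:ℝ) t₀, DifferentiableAt ℝ h t)
    (hhd' : ContinuousOn (deriv h) (Ioc 0 t₀))
    (hhint : IntegrableOn (deriv h) (Ioc 0 t₀))
    (hnonpos : ∀ t ∈ Icc (0:ℝ) t₀, h t ≤ 0)
    (hzero : h t₀ = 0) :
    -(t₀ ^ (-α) * h 0) ≤ ∫ τ in (0:ℝ)..t₀, (t₀ - τ) ^ (-α) * deriv h τ := by
  have hint := intervalIntegrable_sub_rpow_neg_mul hα1 ht₀ hhd' hhint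
  have hcF : ContinuousOn (fun s => ∫ τ in (0:ℝ)..s, (t₀ - τ) ^ (-α) * deriv h τ) (Icc 0 t₀) := by
    have := intervalIntegral.continuousOn_primitive_interval (a := 0) (b := t₀)
      (f := fun τ => (t₀ - τ) ^ (-α) * deriv h τ) (μ := volume) (by
        rw [uIcc_of_le ht₀.le]
        exact (intervalIntegrable_iff_integrableOn_Icc_of_le ht₀.le).1 hint)
    rwa [uIcc_of_le ht₀.le] at this
  have hcont := hcF.sub (continuousOn_sub_rpow_neg_mul hα1 hhc
    (hhd t₀ ⟨ht₀, le_rfl⟩) hzero)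
  have hderiv : ∀ s ∈ Ioo 0 t₀, HasDerivAt
      (fun s => (∫ τ in (0:ℝ)..s, (t₀ - τ) ^ (-α) * deriv h τ) - (t₀ - s) ^ (-α) * h s)
      (-(α * (t₀ - s) ^ (-α - 1) * h s)) s := by
    intro s hs
    have hpos : t₀ - s ≠ 0 := by linarith [hs.2]
    have hcon : ContinuousOn (fun τ => (t₀ - τ) ^ (-α) * deriv h τ) (Ioo 0 t₀) :=
      (ContinuousOn.rpow_const (by fun_prop) fun τ hτ => Or.inl (by linarith [hτ.2])).mul
        (hhd'.mono Ioo_subset_Ioc_self)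
    have hF := intervalIntegral.integral_hasDerivAt_right
      (hint.mono_set (by
        rw [uIcc_of_le hs.1.le, uIcc_of_le ht₀.le]
        exact Icc_subset_Icc_right hs.2.le))
      (hcon.stronglyMeasurableAtFilter isOpen_Ioo s hs)
      (hcon.continuousAt (isOpen_Ioo.mem_nhds hs))
    have hw := ((hasDerivAt_id s).const_sub t₀).rpow_const (p := -α) (Or.inl hpos)
    refine (hF.sub (hw.mul (hhd s ⟨hs.1, hs.2.le⟩).hasDerivAt)).congr_deriv ?_
    simp only [id]
    ring
  have hmono := monotoneOn_of_deriv_nonneg (convex_Icc 0 t₀) hcont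
    (by
      rw [interior_Icc]
      exact fun s hs => (hderiv s hs).differentiableAt.differentiableWithinAt)
    (by
      rw [interior_Icc]
      intro s hs
      refine le_of_le_of_eq ?_ (hderiv s hs).deriv.symm
      have hw : 0 ≤ α * (t₀ - s) ^ (-α - 1) :=
        mul_nonneg hα0.le (Real.rpow_nonneg (by linarith [hs.2]) _)
      exact neg_nonneg.2 (mul_nonpos_of_nonneg_of_nonpos hw (hnonpos s ⟨hs.1.le, hs.2.le⟩)))
  simpa [hzero] using hmono (left_mem_Icc.2 ht₀.le) (right_mem_Icc.2 ht₀.le) ht₀.le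

/-- If `h ≤ 0` on `[0,t₀]`, `h 0 < 0` and `h t₀ = 0` (so `h` attains its maximum at `t₀`),
then `D^α h (t₀) ≥ (h(t₀)-h(0))/(t₀^α Γ(1-α)) = -h(0)/(t₀^α Γ(1-α)) > 0`. -/
theorem caputo_lower_bound_at_max (α t₀ : ℝ) (hα0 : 0 < α) (hα1 : α < 1) (ht₀ : 0 < t₀)
    (h : ℝ → ℝ)
    (hhc : ContinuousOn h (Icc 0 t₀))
    (hhd : ∀ t ∈ Ioc (0:ℝ) t₀, DifferentiableAt ℝ h t)
    (hhd' : ContinuousOn (deriv h) (Ioc 0 t₀))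
    (hhint : IntegrableOn (deriv h) (Ioc 0 t₀))
    (hnonpos : ∀ t ∈ Icc (0:ℝ) t₀, h t ≤ 0)
    (hneg : h 0 < 0)
    (hzero : h t₀ = 0) :
    (h t₀ - h 0) / (t₀ ^ α * Real.Gamma (1 - α)) ≤ caputoD α h t₀ ∧
    (h t₀ - h 0) / (t₀ ^ α * Real.Gamma (1 - α)) = -h 0 / (t₀ ^ α * Real.Gamma (1 - α)) ∧
    0 < -h 0 / (t₀ ^ α * Real.Gamma (1 - α)) := by
  have hG : 0 < Real.Gamma (1 - α) := Real.Gamma_pos_of_pos (by linarith)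
  have ht : 0 < t₀ ^ α := Real.rpow_pos_of_pos ht₀ α
  refine ⟨?_, by rw [hzero, zero_sub], div_pos (by linarith) (mul_pos ht hG)⟩
  have key := neg_mul_rpow_le_integral_sub_rpow_mul_deriv hα0 hα1 ht₀ hhc hhd hhd' hhint
    hnonpos hzero
  calc (h t₀ - h 0) / (t₀ ^ α * Real.Gamma (1 - α))
      = 1 / Real.Gamma (1 - α) * -(t₀ ^ (-α) * h 0) := by
        rw [hzero, Real.rpow_neg ht₀.le]
        field_simp
        ring
    _ ≤ caputoD α h t₀ := mul_le_mul_of_nonneg_left key (by positivity)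
end

section
/- Let 0<α<1, T>0, and let s₁,s₂:[0,T]→ℝ be continuous with s₁(t)<s₂(t) for 0<t≤T. Set D_T = {(x,t): s₁(t)<x<s₂(t), 0<t≤T}, a₀=min_{[0,T]} s₁, b₀=max_{[0,T]} s₂. Let u:[a₀,b₀]×[0,T]→ℝ be such that for each fixed x, t↦u(x,t) is continuously differentiable on (0,T] with t-derivative integrable on (0,T), and u is twice continuously differentiable in x on D_T. If u satisfies the strict differential inequality u_xx(x,t) - D^α_t u(x,t) > 0 at every point of D_T, then there is no point (x₀,t₀)∈D_T at which u attains its maximum over [a₀,b₀]×[0,T]. -/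
open MeasureTheory Set

/-- A real function has nonpositive second derivative at an interior local maximum. -/
theorem deriv_deriv_nonpos_of_isLocalMax {f : ℝ → ℝ} {x : ℝ} (hmax : IsLocalMax f x)
    (hf : ContinuousAt f x) : deriv (deriv f) x ≤ 0 := by
  by_contra! hpos
  have hmin : IsLocalMin f x := isLocalMin_of_deriv_deriv_pos hpos hmax.deriv_eq_zero hf
  have hconst : f =ᶠ[nhds x] fun _ => f x := by
    filter_upwards [hmin, hmax] with y h₁ h₂ using le_antisymm h₂ h₁
  have hzero : deriv (deriv f) x = 0 := by
    rw [hconst.deriv.deriv_eq]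
    simp
  exact hpos.ne' hzero

/-- The Caputo kernel times the increment of a function differentiable at the singularity of the
kernel is continuous up to that singularity. -/
theorem continuousOn_rpow_neg_mul_sub {α a t : ℝ} (hα1 : α < 1) {φ : ℝ → ℝ}
    (hφ : ∀ τ ∈ Icc a t, DifferentiableAt ℝ φ τ) :
    ContinuousOn (fun τ => (t - τ) ^ (-α) * (φ τ - φ t)) (Icc a t) := by
  rcases lt_or_ge t a with hat | hat
  · simp [Icc_eq_empty_of_lt hat]
  have hslope : ContinuousOn (dslope φ t) (Icc a t) := by
    intro τ hτ
    apply ContinuousAt.continuousWithinAt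
    rcases eq_or_ne τ t with rfl | hne
    · exact continuousAt_dslope_same.2 (hφ τ hτ)
    · exact (continuousAt_dslope_of_ne hne).2 (hφ τ hτ).continuousAt
  have hpow : Continuous fun τ : ℝ => (t - τ) ^ (1 - α) :=
    (continuous_const.sub continuous_id).rpow_const fun _ => Or.inr (by linarith)
  refine (hpow.continuousOn.mul hslope).neg.congr fun τ hτ => ?_
  rcases hτ.2.eq_or_lt with rfl | hlt
  · simp [Real.zero_rpow (sub_pos.2 hα1).ne']
  · have hsub : φ τ - φ t = (τ - t) * dslope φ t τ := by
      simpa using (sub_smul_dslope φ t τ).symm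
    have hker : (t - τ) ^ (1 - α) = (t - τ) ^ (-α) * (t - τ) := by
      rw [← Real.rpow_add_one (sub_pos.2 hlt).ne', neg_add_eq_sub]
    simp only [hsub, hker, Pi.neg_apply, Pi.mul_apply]
    ring

/-- The Caputo derivative is nonnegative at a time where the function attains its maximum over
the past. -/
theorem caputoD_nonneg_of_forall_le {α t : ℝ} (hα0 : 0 < α) (hα1 : α < 1) (ht : 0 < t)
    {φ : ℝ → ℝ} (hφ : ∀ τ ∈ Ioc 0 t, DifferentiableAt ℝ φ τ)
    (hmax : ∀ τ ∈ Ioc 0 t, φ τ ≤ φ t) : 0 ≤ caputoD α φ t := by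
  refine mul_nonneg (one_div_nonneg.2 (Real.Gamma_pos_of_pos (by linarith)).le) ?_
  by_cases hint : IntervalIntegrable (fun τ => (t - τ) ^ (-α) * deriv φ τ) volume 0 t
  swap
  · rw [intervalIntegral.integral_undef hint]
  have htail : ∀ ε ∈ Ioo 0 t, 0 ≤ ∫ τ in ε..t, (t - τ) ^ (-α) * deriv φ τ := by
    intro ε hε
    have hle := intervalIntegral.sub_le_integral_of_hasDeriv_right_of_le hε.2.le
      (continuousOn_rpow_neg_mul_sub hα1
        fun τ hτ => hφ τ ⟨hε.1.trans_le hτ.1, hτ.2⟩)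
      (g' := fun τ => (-1 * (-α) * (t - τ) ^ (-α - 1)) * (φ τ - φ t)
        + (t - τ) ^ (-α) * deriv φ τ)
      (φ := fun τ => (t - τ) ^ (-α) * deriv φ τ) ?_ ?_ ?_
    · have hF : (t - ε) ^ (-α) * (φ ε - φ t) ≤ 0 :=
        mul_nonpos_of_nonneg_of_nonpos (Real.rpow_nonneg (by linarith [hε.2]) _)
          (sub_nonpos.2 (hmax ε ⟨hε.1, hε.2.le⟩))
      simp only [sub_self, mul_zero] at hle
      linarith
    · intro τ hτ
      exact ((((hasDerivAt_id τ).const_sub t).rpow_const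
        (Or.inl (sub_pos.2 hτ.2).ne')).mul
        ((hφ τ ⟨hε.1.trans hτ.1, hτ.2.le⟩).hasDerivAt.sub_const (φ t))).hasDerivWithinAt
    · rw [intervalIntegrable_iff_integrableOn_Ioc_of_le ht.le] at hint
      exact hint.mono_set fun τ hτ => ⟨hε.1.trans_le hτ.1, hτ.2⟩
    · intro τ hτ
      have hk : 0 ≤ -1 * (-α) * (t - τ) ^ (-α - 1) := by
        have := Real.rpow_nonneg (sub_pos.2 hτ.2).le (-α - 1)
        have := mul_nonneg hα0.le this
        linarith
      have := mul_nonpos_of_nonneg_of_nonpos hk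
        (sub_nonpos.2 (hmax τ ⟨hε.1.trans hτ.1, hτ.2.le⟩))
      simpa using this
  have hcont : ContinuousOn (fun ε => ∫ τ in ε..t, (t - τ) ^ (-α) * deriv φ τ) (Icc 0 t) := by
    have := intervalIntegral.continuousOn_primitive_interval_left (a := 0) (b := t) (μ := volume)
      (f := fun τ => (t - τ) ^ (-α) * deriv φ τ)
      (by rwa [uIcc_of_le ht.le, integrableOn_Icc_iff_integrableOn_Ioc,
        ← intervalIntegrable_iff_integrableOn_Ioc_of_le ht.le])
    rwa [uIcc_of_le ht.le] at this
  have hclosure : (0 : ℝ) ∈ closure (Ioo 0 t) := by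
    rw [closure_Ioo ht.ne]
    exact left_mem_Icc.2 ht.le
  have := mem_closure_iff_nhdsWithin_neBot.1 hclosure
  exact ge_of_tendsto ((hcont 0 (left_mem_Icc.2 ht.le)).mono Ioo_subset_Icc_self)
    (Filter.eventually_of_mem self_mem_nhdsWithin htail)

/-- If `L^α[u] = u_xx - D^α_t u > 0` on the moving-boundary domain `D_T`,
then `u` cannot attain its maximum over `[a₀,b₀] × [0,T]` at a point of `D_T`. -/
theorem no_interior_max_of_strict_subsolution
    (α T a₀ b₀ : ℝ) (hα0 : 0 < α) (hα1 : α < 1) (hT : 0 < T)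
    (s₁ s₂ : ℝ → ℝ)
    (hs₁c : ContinuousOn s₁ (Icc 0 T)) (hs₂c : ContinuousOn s₂ (Icc 0 T))
    (hs : ∀ t ∈ Ioc (0:ℝ) T, s₁ t < s₂ t)
    (ha₀ : IsLeast (s₁ '' Icc 0 T) a₀) (hb₀ : IsGreatest (s₂ '' Icc 0 T) b₀)
    (u : ℝ → ℝ → ℝ)
    (hut : ∀ x ∈ Icc a₀ b₀,
      (∀ t ∈ Ioc (0:ℝ) T, DifferentiableAt ℝ (u x) t) ∧
      ContinuousOn (deriv (u x)) (Ioc 0 T) ∧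
      IntegrableOn (deriv (u x)) (Ioc 0 T))
    (hux : ∀ t ∈ Ioc (0:ℝ) T, ∀ x ∈ Ioo (s₁ t) (s₂ t),
      DifferentiableAt ℝ (fun x' => u x' t) x ∧
      DifferentiableAt ℝ (deriv fun x' => u x' t) x ∧
      ContinuousAt (deriv (deriv fun x' => u x' t)) x)
    (hstrict : ∀ t ∈ Ioc (0:ℝ) T, ∀ x ∈ Ioo (s₁ t) (s₂ t),
      0 < deriv (deriv fun x' => u x' t) x - caputoD α (u x) t) :
    ¬ ∃ t₀ ∈ Ioc (0:ℝ) T, ∃ x₀ ∈ Ioo (s₁ t₀) (s₂ t₀),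
      ∀ x ∈ Icc a₀ b₀, ∀ t ∈ Icc (0:ℝ) T, u x t ≤ u x₀ t₀ := by
  rintro ⟨t₀, ht₀, x₀, hx₀, hmax⟩
  have ht₀' : t₀ ∈ Icc 0 T := Ioc_subset_Icc_self ht₀
  have hsub : Ioo (s₁ t₀) (s₂ t₀) ⊆ Icc a₀ b₀ := fun x hx =>
    ⟨(ha₀.2 (mem_image_of_mem s₁ ht₀')).trans hx.1.le,
      hx.2.le.trans (hb₀.2 (mem_image_of_mem s₂ ht₀'))⟩
  have hspace : IsLocalMax (fun x => u x t₀) x₀ := by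
    filter_upwards [isOpen_Ioo.mem_nhds hx₀] with x hx using hmax x (hsub hx) t₀ ht₀'
  have huxx := deriv_deriv_nonpos_of_isLocalMax hspace (hux t₀ ht₀ x₀ hx₀).1.continuousAt
  have hcaputo : 0 ≤ caputoD α (u x₀) t₀ :=
    caputoD_nonneg_of_forall_le hα0 hα1 ht₀.1
      (fun τ hτ => (hut x₀ (hsub hx₀)).1 τ ⟨hτ.1, hτ.2.trans ht₀.2⟩)
      fun τ hτ => hmax x₀ (hsub hx₀) τ ⟨hτ.1.le, hτ.2.trans ht₀.2⟩
  linarith [hstrict t₀ ht₀ x₀ hx₀]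
end

section
/- Let 0<α<1, T>0, and let s₁,s₂:[0,T]→ℝ be continuous with s₁(t)<s₂(t) for 0<t≤T. Set D_T = {(x,t): s₁(t)<x<s₂(t), 0<t≤T}, a₀=min_{[0,T]} s₁, b₀=max_{[0,T]} s₂. Let u:[a₀,b₀]×[0,T]→ℝ be such that for each fixed x, t↦u(x,t) is continuously differentiable on (0,T] with t-derivative integrable on (0,T), and u is twice continuously differentiable in x on D_T. If u satisfies the strict differential inequality u_xx(x,t) - D^α_t u(x,t) < 0 at every point of D_T, then there is no point (x₀,t₀)∈D_T at which u attains its minimum over [a₀,b₀]×[0,T]. -/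
open MeasureTheory Set

/-- The second derivative is nonnegative at a local minimum. -/
theorem deriv_deriv_nonneg_of_isLocalMin {f : ℝ → ℝ} {x : ℝ} (hmin : IsLocalMin f x)
    (hf : ContinuousAt f x) : 0 ≤ deriv (deriv f) x := by
  by_contra! hneg
  have hmax : IsLocalMax f x := isLocalMax_of_deriv_deriv_neg hneg hmin.deriv_eq_zero hf
  have hconst : f =ᶠ[nhds x] fun _ => f x := by
    filter_upwards [hmin, hmax] with y h₁ h₂ using le_antisymm h₂ h₁
  have hzero : deriv (deriv f) x = 0 := by
    rw [hconst.deriv.deriv_eq]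
    simp
  exact hneg.ne hzero

/-- Integrating `(t - τ) ^ (-α) * φ' τ` over a compact part of `(0, t)` gives at most the boundary
term at the right endpoint when `φ` is minimal at `t`. -/
theorem integral_rpow_neg_mul_deriv_le {α t a b : ℝ} {φ : ℝ → ℝ} (hα : 0 ≤ α) (hab : a ≤ b)
    (hbt : b < t) (hd : ∀ τ ∈ Icc a b, DifferentiableAt ℝ φ τ)
    (hmin : ∀ τ ∈ Icc a b, φ t ≤ φ τ)
    (hint : IntegrableOn (fun τ => (t - τ) ^ (-α) * deriv φ τ) (Icc a b)) :
    ∫ τ in a..b, (t - τ) ^ (-α) * deriv φ τ ≤ (t - b) ^ (-α) * (φ b - φ t) := by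
  have hderiv : ∀ τ ∈ Icc a b, HasDerivAt (fun τ => (t - τ) ^ (-α) * (φ τ - φ t))
      (-1 * (-α) * (t - τ) ^ (-α - 1) * (φ τ - φ t) + (t - τ) ^ (-α) * deriv φ τ) τ := by
    intro τ hτ
    have hpos : t - τ ≠ 0 := by linarith [hτ.2]
    exact (((hasDerivAt_id τ).const_sub t).rpow_const (Or.inl hpos)).mul
      ((hd τ hτ).hasDerivAt.sub_const _)
  have key := intervalIntegral.integral_le_sub_of_hasDeriv_right_of_le hab
    (fun τ hτ => (hderiv τ hτ).continuousAt.continuousWithinAt)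
    (fun τ hτ => (hderiv τ (Ioo_subset_Icc_self hτ)).hasDerivWithinAt) hint
    (fun τ hτ => by
      have h₁ : 0 ≤ (t - τ) ^ (-α - 1) := Real.rpow_nonneg (by linarith [hτ.2]) _
      have h₂ : 0 ≤ φ τ - φ t := sub_nonneg.2 (hmin τ (Ioo_subset_Icc_self hτ))
      have h₃ := mul_nonneg (mul_nonneg hα h₁) h₂
      linarith)
  have ha : 0 ≤ (t - a) ^ (-α) * (φ a - φ t) :=
    mul_nonneg (Real.rpow_nonneg (by linarith) _)
      (sub_nonneg.2 (hmin a (left_mem_Icc.2 hab)))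
  linarith

/-- The Caputo derivative is nonpositive at a minimum over the past. -/
theorem caputoD_nonpos_of_forall_le {α t : ℝ} {φ : ℝ → ℝ} (hα0 : 0 ≤ α) (hα1 : α < 1)
    (ht : 0 < t) (hd : ∀ τ ∈ Ioc 0 t, DifferentiableAt ℝ φ τ)
    (hmin : ∀ τ ∈ Ioc 0 t, φ t ≤ φ τ) : caputoD α φ t ≤ 0 := by
  have hΓ : 0 ≤ 1 / Real.Gamma (1 - α) := by
    have := Real.Gamma_pos_of_pos (sub_pos.2 hα1)
    positivity
  refine mul_nonpos_of_nonneg_of_nonpos hΓ ?_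
  set f : ℝ → ℝ := fun τ => (t - τ) ^ (-α) * deriv φ τ
  by_cases hint : IntervalIntegrable f volume 0 t
  swap
  · exact (intervalIntegral.integral_undef hint).le
  have hII : IntegrableOn f (Icc 0 t) :=
    (intervalIntegrable_iff_integrableOn_Icc_of_le ht.le).1 hint
  have hF : ContinuousOn (fun s => ∫ τ in (0 : ℝ)..s, f τ) (Icc 0 t) :=
    (intervalIntegral.continuousOn_primitive_interval (by rwa [uIcc_of_le ht.le])).mono
      (by rw [uIcc_of_le ht.le])
  have hsmall : ∀ᶠ ε in nhdsWithin (0 : ℝ) (Ioi 0), ε ∈ Ioo 0 (t / 2) :=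
    Ioo_mem_nhdsGT (by positivity)
  have hid : Filter.Tendsto (fun ε : ℝ => ε) (nhdsWithin 0 (Ioi 0)) (nhds 0) :=
    Filter.tendsto_id.mono_left nhdsWithin_le_nhds
  have hsub : Filter.Tendsto (fun ε : ℝ => t - ε) (nhdsWithin 0 (Ioi 0)) (nhds t) := by
    simpa using hid.const_sub t
  have hleft : Filter.Tendsto (fun ε => ∫ τ in (0 : ℝ)..ε, f τ) (nhdsWithin 0 (Ioi 0))
      (nhds 0) := by
    have := (hF 0 (left_mem_Icc.2 ht.le)).tendsto.comp (tendsto_nhdsWithin_iff.2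
      ⟨hid, hsmall.mono fun ε hε => ⟨hε.1.le, by linarith [hε.2]⟩⟩)
    simpa [Function.comp_def] using this
  have hright : Filter.Tendsto (fun ε => ∫ τ in (0 : ℝ)..(t - ε), f τ) (nhdsWithin 0 (Ioi 0))
      (nhds (∫ τ in (0 : ℝ)..t, f τ)) :=
    (hF t (right_mem_Icc.2 ht.le)).tendsto.comp (tendsto_nhdsWithin_iff.2
      ⟨hsub, hsmall.mono fun ε hε => ⟨by linarith [hε.2], by linarith [hε.1]⟩⟩)
  obtain ⟨C, hC⟩ := (hd t ⟨ht, le_rfl⟩).isBigO_sub.bound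
  have hpow : Filter.Tendsto (fun ε : ℝ => C * ε ^ (1 - α)) (nhdsWithin 0 (Ioi 0))
      (nhds 0) := by
    have := ((Real.continuousAt_rpow_const 0 (1 - α) (Or.inr (sub_nonneg.2 hα1.le))).tendsto.comp
      hid).const_mul C
    simpa [Function.comp_def, Real.zero_rpow (sub_pos.2 hα1).ne'] using this
  refine le_of_tendsto_of_tendsto (by simpa using hright.sub hleft) hpow ?_
  filter_upwards [hsmall, hsub.eventually hC] with ε hε hCε
  have hε2 := hε.2
  have hε1 := hε.1
  have hsubset : Icc ε (t - ε) ⊆ Ioc 0 t := fun τ hτ =>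
    ⟨hε1.trans_le hτ.1, by linarith [hτ.2]⟩
  have hint' : ∀ s ∈ Icc 0 t, IntervalIntegrable f volume 0 s := fun s hs =>
    (intervalIntegrable_iff_integrableOn_Icc_of_le hs.1).2
      (hII.mono_set (Icc_subset_Icc_right hs.2))
  rw [intervalIntegral.integral_interval_sub_left (hint' _ ⟨by linarith, by linarith⟩)
    (hint' _ ⟨hε1.le, by linarith⟩)]
  have hle := integral_rpow_neg_mul_deriv_le hα0 (by linarith : ε ≤ t - ε) (by linarith)
    (fun τ hτ => hd τ (hsubset hτ)) (fun τ hτ => hmin τ (hsubset hτ))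
    (hII.mono_set (hsubset.trans Ioc_subset_Icc_self))
  refine hle.trans ?_
  have hC' : φ (t - ε) - φ t ≤ C * ε := by
    have := (le_abs_self _).trans hCε
    simpa [abs_of_pos hε1] using this
  calc (t - (t - ε)) ^ (-α) * (φ (t - ε) - φ t) ≤ ε ^ (-α) * (C * ε) := by
        rw [sub_sub_cancel]
        exact mul_le_mul_of_nonneg_left hC' (Real.rpow_nonneg hε1.le _)
    _ = C * ε ^ (1 - α) := by
        rw [sub_eq_neg_add, Real.rpow_add hε1, Real.rpow_one]
        ring

/-- If `L^α[u] = u_xx - D^α_t u < 0` on the moving-boundary domain `D_T`,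
then `u` cannot attain its minimum over `[a₀,b₀] × [0,T]` at a point of `D_T`. -/
theorem no_interior_min_of_strict_supersolution
    (α T a₀ b₀ : ℝ) (hα0 : 0 < α) (hα1 : α < 1) (hT : 0 < T)
    (s₁ s₂ : ℝ → ℝ)
    (hs₁c : ContinuousOn s₁ (Icc 0 T)) (hs₂c : ContinuousOn s₂ (Icc 0 T))
    (hs : ∀ t ∈ Ioc (0:ℝ) T, s₁ t < s₂ t)
    (ha₀ : IsLeast (s₁ '' Icc 0 T) a₀) (hb₀ : IsGreatest (s₂ '' Icc 0 T) b₀)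
    (u : ℝ → ℝ → ℝ)
    (hut : ∀ x ∈ Icc a₀ b₀,
      (∀ t ∈ Ioc (0:ℝ) T, DifferentiableAt ℝ (u x) t) ∧
      ContinuousOn (deriv (u x)) (Ioc 0 T) ∧
      IntegrableOn (deriv (u x)) (Ioc 0 T))
    (hux : ∀ t ∈ Ioc (0:ℝ) T, ∀ x ∈ Ioo (s₁ t) (s₂ t),
      DifferentiableAt ℝ (fun x' => u x' t) x ∧
      DifferentiableAt ℝ (deriv fun x' => u x' t) x ∧
      ContinuousAt (deriv (deriv fun x' => u x' t)) x)
    (hstrict : ∀ t ∈ Ioc (0:ℝ) T, ∀ x ∈ Ioo (s₁ t) (s₂ t),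
      deriv (deriv fun x' => u x' t) x - caputoD α (u x) t < 0) :
    ¬ ∃ t₀ ∈ Ioc (0:ℝ) T, ∃ x₀ ∈ Ioo (s₁ t₀) (s₂ t₀),
      ∀ x ∈ Icc a₀ b₀, ∀ t ∈ Icc (0:ℝ) T, u x₀ t₀ ≤ u x t := by
  rintro ⟨t₀, ht₀, x₀, hx₀, hmin⟩
  have hl : a₀ < x₀ := (ha₀.2 ⟨t₀, Ioc_subset_Icc_self ht₀, rfl⟩).trans_lt hx₀.1
  have hr : x₀ < b₀ := hx₀.2.trans_le (hb₀.2 ⟨t₀, Ioc_subset_Icc_self ht₀, rfl⟩)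
  have hxx : 0 ≤ deriv (deriv fun x' => u x' t₀) x₀ := by
    refine deriv_deriv_nonneg_of_isLocalMin ?_ (hux t₀ ht₀ x₀ hx₀).1.continuousAt
    filter_upwards [Icc_mem_nhds hl hr] with x hx
      using hmin x hx t₀ (Ioc_subset_Icc_self ht₀)
  have hcap : caputoD α (u x₀) t₀ ≤ 0 :=
    caputoD_nonpos_of_forall_le hα0.le hα1 ht₀.1
      (fun τ hτ => (hut x₀ ⟨hl.le, hr.le⟩).1 τ ⟨hτ.1, hτ.2.trans ht₀.2⟩)
      (fun τ hτ => hmin x₀ ⟨hl.le, hr.le⟩ τ ⟨hτ.1.le, hτ.2.trans ht₀.2⟩)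
  linarith [hstrict t₀ ht₀ x₀ hx₀]
end

section
/- Let 0<α<1 and λ>0. For every t>0, the function t ↦ E_α(λ t^α) is differentiable at t with derivative λ t^{α-1} E_{α,α}(λ t^α), where E_α and E_{α,α} are the one- and two-parameter Mittag-Leffler functions. -/
open MeasureTheory Set Filter

/-- The one-parameter Mittag-Leffler function `E_α(z) = Σ_{k≥0} z^k / Γ(αk+1)`. -/
noncomputable def mittagLeffler (α z : ℝ) : ℝ :=
  ∑' k : ℕ, z ^ k / Real.Gamma (α * k + 1)

/-- The two-parameter Mittag-Leffler function `E_{α,β}(z) = Σ_{k≥0} z^k / Γ(αk+β)`. -/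
noncomputable def mittagLeffler₂ (α β z : ℝ) : ℝ :=
  ∑' k : ℕ, z ^ k / Real.Gamma (α * k + β)

/-- Log-convexity of `Γ` bounds the growth of `Γ` over a step `α ∈ (0, 1)` from below. -/
theorem rpow_mul_Gamma_le_Gamma_add {α x : ℝ} (hα0 : 0 < α) (hα1 : α < 1) (hx : 1 < x + α) :
    (x + α - 1) ^ α * Real.Gamma x ≤ Real.Gamma (x + α) := by
  have hy : 0 < x + α - 1 := by linarith
  have h := Real.Gamma_mul_add_mul_le_rpow_Gamma_mul_rpow_Gamma (s := x + α) (t := x + α - 1)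
    (a := 1 - α) (b := α) (by linarith) hy (by linarith) hα0 (by ring)
  have e : (1 - α) * (x + α) + α * (x + α - 1) = x := by ring
  have hG : Real.Gamma (x + α) = (x + α - 1) * Real.Gamma (x + α - 1) := by
    rw [← Real.Gamma_add_one hy.ne']; ring_nf
  have hGp : 0 < Real.Gamma (x + α) := Real.Gamma_pos_of_pos (by linarith)
  rw [e] at h
  calc (x + α - 1) ^ α * Real.Gamma x
      ≤ (x + α - 1) ^ α *
          (Real.Gamma (x + α) ^ (1 - α) * Real.Gamma (x + α - 1) ^ α) := by gcongr
    _ = Real.Gamma (x + α) ^ (1 - α) *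
          ((x + α - 1) * Real.Gamma (x + α - 1)) ^ α := by
        rw [Real.mul_rpow hy.le (Real.Gamma_pos_of_pos hy).le]; ring
    _ = Real.Gamma (x + α) := by
        rw [← hG, ← Real.rpow_add hGp, sub_add_cancel, Real.rpow_one]

theorem summable_pow_div_Gamma {α β z : ℝ} (hα0 : 0 < α) (hα1 : α < 1) (hβ : 0 < β)
    (hz : 0 < z) : Summable fun k : ℕ => z ^ k / Real.Gamma (α * k + β) := by
  have hGpos : ∀ k : ℕ, 0 < Real.Gamma (α * k + β) := fun k =>
    Real.Gamma_pos_of_pos (by positivity)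
  have hlin : Tendsto (fun k : ℕ => α * (k : ℝ) + β + α - 1) atTop atTop := by
    have h := tendsto_atTop_add_const_right atTop (β + α - 1)
      ((tendsto_natCast_atTop_atTop (R := ℝ)).const_mul_atTop hα0)
    exact h.congr fun k => by ring
  have hlim : Tendsto (fun k : ℕ => z / (α * (k : ℝ) + β + α - 1) ^ α) atTop (nhds 0) :=
    ((tendsto_rpow_atTop hα0).comp hlin).const_div_atTop z
  refine summable_of_ratio_test_tendsto_lt_one zero_lt_one
    (Eventually.of_forall fun k => (div_pos (pow_pos hz k) (hGpos k)).ne') ?_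
  refine tendsto_of_tendsto_of_tendsto_of_le_of_le' tendsto_const_nhds hlim
    (Eventually.of_forall fun k => by positivity) ?_
  filter_upwards [hlin.eventually_gt_atTop 0] with k hk
  have hle := rpow_mul_Gamma_le_Gamma_add (x := α * k + β) hα0 hα1 (by linarith)
  have e : α * ((k + 1 : ℕ) : ℝ) + β = α * k + β + α := by push_cast; ring
  have hG' : 0 < Real.Gamma (α * k + β + α) := by rw [← e]; exact hGpos (k + 1)
  have hk' := Real.rpow_pos_of_pos hk α
  rw [e, Real.norm_of_nonneg (by positivity),
    Real.norm_of_nonneg (div_pos (pow_pos hz k) (hGpos k)).le, div_div_div_eq, pow_succ,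
    div_le_div_iff₀ (mul_pos hG' (pow_pos hz k)) hk']
  have := mul_le_mul_of_nonneg_left hle (mul_pos (pow_pos hz k) hz).le
  linarith

/-- The reindexed term of the differentiated Mittag-Leffler series. -/
theorem succ_mul_pow_div_Gamma {α : ℝ} (hα0 : 0 < α) (z : ℝ) (k : ℕ) :
    ((k + 1 : ℕ) : ℝ) * z ^ (k + 1 - 1) / Real.Gamma (α * (k + 1 : ℕ) + 1) =
      α⁻¹ * (z ^ k / Real.Gamma (α * k + α)) := by
  have hp : 0 < α * (k : ℝ) + α := by positivity
  have hG := (Real.Gamma_pos_of_pos hp).ne'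
  have hk : (k : ℝ) + 1 ≠ 0 := by positivity
  have e : α * ((k + 1 : ℕ) : ℝ) + 1 = α * k + α + 1 := by push_cast; ring
  have e' : α * (k : ℝ) + α = α * (k + 1) := by ring
  rw [e, Real.Gamma_add_one hp.ne', Nat.add_sub_cancel]
  generalize Real.Gamma (α * (k : ℝ) + α) = G at hG ⊢
  rw [e']
  push_cast
  field_simp

theorem hasDerivAt_mittagLeffler {α : ℝ} (hα0 : 0 < α) (hα1 : α < 1) (z : ℝ) :
    HasDerivAt (mittagLeffler α) (α⁻¹ * mittagLeffler₂ α α z) z := by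
  set R : ℝ := |z| + 1 with hR
  have hR0 : 0 < R := by positivity
  have hGpos : ∀ k : ℕ, 0 < Real.Gamma (α * k + 1) := fun k =>
    Real.Gamma_pos_of_pos (by positivity)
  have hu : Summable fun k : ℕ => (k : ℝ) * R ^ (k - 1) / Real.Gamma (α * k + 1) := by
    rw [← summable_nat_add_iff 1]
    simp_rw [succ_mul_pow_div_Gamma hα0]
    exact (summable_pow_div_Gamma hα0 hα1 hα0 hR0).mul_left _
  have hbound : ∀ (k : ℕ) (y : ℝ), y ∈ Metric.ball (0 : ℝ) R →
      ‖(k : ℝ) * y ^ (k - 1) / Real.Gamma (α * k + 1)‖ ≤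
        (k : ℝ) * R ^ (k - 1) / Real.Gamma (α * k + 1) := by
    intro k y hy
    have hy' : ‖y‖ ≤ R := (mem_ball_zero_iff.mp hy).le
    have := hGpos k
    rw [norm_div, norm_mul, norm_pow, Real.norm_natCast, Real.norm_of_nonneg this.le]
    gcongr
  have hzR : z ∈ Metric.ball (0 : ℝ) R := by
    rw [mem_ball_zero_iff, Real.norm_eq_abs, hR]; linarith
  have hd := hasDerivAt_tsum_of_isPreconnected
    (g := fun (k : ℕ) (y : ℝ) => y ^ k / Real.Gamma (α * k + 1)) hu Metric.isOpen_ball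
    (convex_ball (0 : ℝ) R).isPreconnected
    (fun k y _ => (hasDerivAt_pow k y).div_const (Real.Gamma (α * k + 1)))
    hbound (Metric.mem_ball_self hR0)
    (summable_of_ne_finset_zero (s := {0}) fun k hk => by
      simp [show k ≠ 0 by simpa using hk]) hzR
  have hs : Summable fun k : ℕ => (k : ℝ) * z ^ (k - 1) / Real.Gamma (α * k + 1) :=
    hu.of_norm_bounded fun k => hbound k z hzR
  refine HasDerivAt.congr_deriv (f := mittagLeffler α) hd ?_
  rw [hs.tsum_eq_zero_add]
  simp_rw [succ_mul_pow_div_Gamma hα0]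
  rw [tsum_mul_left, mittagLeffler₂]
  simp

/-- For `0 < α < 1` and `λ > 0`, the function `t ↦ E_α(λ t^α)` is differentiable at every
`t > 0` with derivative `λ t^(α-1) E_{α,α}(λ t^α)`. -/
theorem hasDerivAt_mittagLeffler_rpow (α lam : ℝ) (hα0 : 0 < α) (hα1 : α < 1)
    (hlam : 0 < lam) :
    ∀ t : ℝ, 0 < t →
      HasDerivAt (fun t' => mittagLeffler α (lam * t' ^ α))
        (lam * t ^ (α - 1) * mittagLeffler₂ α α (lam * t ^ α)) t := by
  intro t ht
  have h := (hasDerivAt_mittagLeffler hα0 hα1 (lam * t ^ α)).comp t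
    ((Real.hasDerivAt_rpow_const (p := α) (Or.inl ht.ne')).const_mul lam)
  refine h.congr_deriv ?_
  field_simp
end

section
/- Let 0<α<1, A>0, μ = A+1, ε>0, t₀>0, c∈ℝ, M∈ℝ, and define w(x,t) = ε[1 - exp(-μ(x-c))·E_α(μ A t^α)/E_α(μ A t₀^α)] + M. Then for every x∈ℝ and every t∈(0,t₀], L^α[w](x,t) = w_xx(x,t) - D^α_t w(x,t) = ε exp(-μ(x-c))·(E_α(μ A t^α)/E_α(μ A t₀^α))·(μA - μ²) < 0; that is, w is a strict supersolution of the fractional diffusion equation. -/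
open MeasureTheory Set Filter

/-- The barrier function
`w(x,t) = ε [1 - exp(-μ(x-c)) E_α(μA t^α)/E_α(μA t₀^α)] + M`. -/
noncomputable def barrierW (α A μ ε t₀ c M x t : ℝ) : ℝ :=
  ε * (1 - Real.exp (-μ * (x - c)) *
    (mittagLeffler α (μ * A * t ^ α) / mittagLeffler α (μ * A * t₀ ^ α))) + M

theorem rpow_mul_exp_neg_le_Gamma {R s : ℝ} (hR : 0 < R) (hs : 1 ≤ s) :
    R ^ (s - 1) * Real.exp (-R) ≤ Real.Gamma s := by
  have hs0 : 0 < s := by linarith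
  have hsub : Ioi R ⊆ Ioi (0 : ℝ) := Ioi_subset_Ioi hR.le
  calc R ^ (s - 1) * Real.exp (-R) = ∫ x in Ioi R, R ^ (s - 1) * Real.exp (-x) := by
        rw [integral_const_mul, integral_exp_neg_Ioi]
    _ ≤ ∫ x in Ioi R, Real.exp (-x) * x ^ (s - 1) := by
        refine setIntegral_mono_on ((integrableOn_exp_neg_Ioi R).const_mul _)
          ((Real.GammaIntegral_convergent hs0).mono_set hsub) measurableSet_Ioi fun x hx => ?_
        rw [mul_comm]
        have : R ≤ x := le_of_lt hx
        gcongr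
    _ ≤ ∫ x in Ioi (0 : ℝ), Real.exp (-x) * x ^ (s - 1) := by
        refine setIntegral_mono_set (Real.GammaIntegral_convergent hs0) ?_ hsub.eventuallyLE
        filter_upwards [ae_restrict_mem measurableSet_Ioi] with x hx
        have : (0 : ℝ) < x := hx
        positivity
    _ = Real.Gamma s := (Real.Gamma_eq_integral hs0).symm

theorem summable_natCast_mul_pow_div_Gamma {α : ℝ} (hα : 0 < α) (z : ℝ) (m : ℕ) :
    Summable fun k : ℕ => (k : ℝ) ^ m * z ^ k / Real.Gamma (α * k + 1) := by
  set R : ℝ := (2 * |z| + 1) ^ α⁻¹ with hRdef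
  have hb : 0 < 2 * |z| + 1 := by positivity
  have hR : 0 < R := by positivity
  have hRα : ∀ k : ℕ, R ^ (α * k + 1 - 1) = (2 * |z| + 1) ^ k := fun k => by
    rw [hRdef, ← Real.rpow_mul hb.le, ← Real.rpow_natCast]
    congr 1
    field_simp
    ring
  have hq : ‖|z| / (2 * |z| + 1)‖ < 1 := by
    rw [Real.norm_of_nonneg (by positivity), div_lt_one hb]
    linarith [abs_nonneg z]
  refine Summable.of_norm_bounded
    ((summable_pow_mul_geometric_of_norm_lt_one m hq).mul_left (Real.exp R)) fun k => ?_
  have hG := rpow_mul_exp_neg_le_Gamma (s := α * k + 1) hR (by simpa using by positivity)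
  rw [hRα] at hG
  have hpos : 0 < (2 * |z| + 1) ^ k * Real.exp (-R) := by positivity
  rw [norm_div, norm_mul, norm_pow, norm_pow, Real.norm_natCast,
    Real.norm_of_nonneg (hpos.le.trans hG), Real.norm_eq_abs]
  calc (k : ℝ) ^ m * |z| ^ k / Real.Gamma (α * k + 1)
      ≤ (k : ℝ) ^ m * |z| ^ k / ((2 * |z| + 1) ^ k * Real.exp (-R)) := by gcongr
    _ = Real.exp R * ((k : ℝ) ^ m * (|z| / (2 * |z| + 1)) ^ k) := by
        rw [Real.exp_neg, div_pow]
        field_simp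

theorem summable_mittagLeffler {α : ℝ} (hα : 0 < α) (z : ℝ) :
    Summable fun k : ℕ => z ^ k / Real.Gamma (α * k + 1) := by
  simpa using summable_natCast_mul_pow_div_Gamma hα z 0

theorem mittagLeffler_pos {α z : ℝ} (hα : 0 < α) (hz : 0 ≤ z) : 0 < mittagLeffler α z := by
  refine (summable_mittagLeffler hα z).tsum_pos (fun k => ?_) 0 (by simp)
  have : 0 < Real.Gamma (α * k + 1) := Real.Gamma_pos_of_pos (by positivity)
  positivity

theorem hasDerivAt_mittagLeffler_const_mul_rpow {α l t : ℝ} (hα : 0 < α) (ht : 0 < t) :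
    HasDerivAt (fun τ => mittagLeffler α (l * τ ^ α))
      (∑' k : ℕ, l ^ k / Real.Gamma (α * k + 1) * (α * k * t ^ (α * k - 1))) t := by
  have hterm : ∀ (k : ℕ) {τ : ℝ}, 0 < τ →
      (l * τ ^ α) ^ k / Real.Gamma (α * k + 1) =
        l ^ k / Real.Gamma (α * k + 1) * τ ^ (α * k) := fun k τ hτ => by
    rw [mul_pow, ← Real.rpow_natCast (τ ^ α), ← Real.rpow_mul hτ.le]
    ring
  have hbound := (summable_natCast_mul_pow_div_Gamma hα (|l| * (2 * t) ^ α) 1).mul_left (α * (2 / t))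
  have key := hasDerivAt_tsum_of_isPreconnected (y₀ := t) (y := t) (t := Ioo (t / 2) (2 * t))
    (g := fun (k : ℕ) τ => l ^ k / Real.Gamma (α * k + 1) * τ ^ (α * k))
    (g' := fun (k : ℕ) τ => l ^ k / Real.Gamma (α * k + 1) * (α * k * τ ^ (α * k - 1)))
    hbound isOpen_Ioo isPreconnected_Ioo
    (fun k τ hτ => (Real.hasDerivAt_rpow_const
      (Or.inl (by linarith [hτ.1] : (0 : ℝ) < τ).ne')).const_mul _)
    (fun k τ hτ => ?_) ⟨by linarith, by linarith⟩ ?_ ⟨by linarith, by linarith⟩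
  · refine key.congr_of_eventuallyEq ?_
    filter_upwards [Ioi_mem_nhds ht] with τ hτ
    exact tsum_congr fun k => hterm k hτ
  · have hτ0 : 0 < τ := by linarith [hτ.1]
    have hG : 0 < Real.Gamma (α * k + 1) := Real.Gamma_pos_of_pos (by positivity)
    rw [norm_mul, norm_div, norm_pow, Real.norm_of_nonneg hG.le, Real.norm_of_nonneg
      (by positivity : 0 ≤ α * k * τ ^ (α * k - 1)), Real.norm_eq_abs, Real.rpow_sub_one hτ0.ne',
      mul_pow, ← Real.rpow_natCast ((2 * t) ^ α), ← Real.rpow_mul (by positivity)]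
    calc |l| ^ k / Real.Gamma (α * k + 1) * (α * k * (τ ^ (α * k) / τ))
        ≤ |l| ^ k / Real.Gamma (α * k + 1) * (α * k * ((2 * t) ^ (α * k) / (t / 2))) := by
          gcongr
          · exact hτ.2.le
          · exact hτ.1.le
      _ = _ := by field_simp
  · exact (summable_mittagLeffler hα (l * t ^ α)).congr fun k => hterm k ht

theorem integral_rpow_mul_sub_rpow {a b t : ℝ} (ha : 0 < a) (hb : 0 < b) (ht : 0 < t) :
    ∫ τ in (0 : ℝ)..t, τ ^ (a - 1) * (t - τ) ^ (b - 1) =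
      t ^ (a + b - 1) * (Real.Gamma a * Real.Gamma b / Real.Gamma (a + b)) := by
  have h := Complex.betaIntegral_scaled a b ht
  rw [Complex.betaIntegral_eq_Gamma_mul_div _ _ (by simpa) (by simpa)] at h
  apply Complex.ofReal_injective
  rw [← intervalIntegral.integral_ofReal]
  push_cast [Complex.ofReal_cpow ht.le, ← Complex.Gamma_ofReal]
  rw [← h]
  refine intervalIntegral.integral_congr fun τ hτ => ?_
  rw [uIcc_of_le ht.le] at hτ
  simp [Complex.ofReal_cpow hτ.1, Complex.ofReal_cpow (sub_nonneg.2 hτ.2)]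

theorem caputoD_mittagLeffler {α l t : ℝ} (hα0 : 0 < α) (hα1 : α < 1) (hl : 0 ≤ l)
    (ht : 0 < t) :
    caputoD α (fun τ => mittagLeffler α (l * τ ^ α)) t = l * mittagLeffler α (l * t ^ α) := by
  have hΓ : 0 < Real.Gamma (1 - α) := Real.Gamma_pos_of_pos (by linarith)
  set F : ℕ → ℝ → ℝ := fun k τ =>
    (t - τ) ^ (-α) * (l ^ k / Real.Gamma (α * k + 1) * (α * k * τ ^ (α * k - 1))) with hF
  have hF0 : ∀ τ, F 0 τ = 0 := fun τ => by simp [hF]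
  have hFnonneg : ∀ k, ∀ τ ∈ Ioc 0 t, 0 ≤ F k τ := fun k τ hτ => by
    have : 0 < Real.Gamma (α * k + 1) := Real.Gamma_pos_of_pos (by positivity)
    have := Real.rpow_nonneg (sub_nonneg.2 hτ.2) (-α)
    have := hτ.1
    positivity
  have hrw : ∀ k : ℕ, F (k + 1) = fun τ =>
      (l ^ (k + 1) / Real.Gamma (α * (k + 1 : ℕ) + 1) * (α * (k + 1 : ℕ))) *
        (τ ^ (α * (k + 1 : ℕ) - 1) * (t - τ) ^ ((1 - α) - 1)) := fun k => by
    ext τ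
    rw [hF, show (1 - α) - 1 = -α by ring]
    ring
  have hpos : ∀ k : ℕ, 0 < α * (k + 1 : ℕ) := fun k => by positivity
  have hF_integral : ∀ k : ℕ, ∫ τ in (0 : ℝ)..t, F (k + 1) τ =
      Real.Gamma (1 - α) * (l * ((l * t ^ α) ^ k / Real.Gamma (α * k + 1))) := fun k => by
    rw [hrw, intervalIntegral.integral_const_mul,
      integral_rpow_mul_sub_rpow (hpos k) (sub_pos.2 hα1) ht, Real.Gamma_add_one (hpos k).ne',
      mul_pow, ← Real.rpow_natCast (t ^ α), ← Real.rpow_mul ht.le,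
      show α * (k + 1 : ℕ) + (1 - α) - 1 = α * k by push_cast; ring,
      show α * (k + 1 : ℕ) + (1 - α) = α * k + 1 by push_cast; ring]
    have := (hpos k).ne'
    have := (Real.Gamma_pos_of_pos (hpos k)).ne'
    field_simp
    ring
  have hFint : ∀ k, IntegrableOn (F k) (Ioc 0 t) := fun k => by
    cases k with
    | zero => simp [funext hF0]
    | succ k =>
      rw [hrw]
      refine Integrable.const_mul (Integrable.of_integral_ne_zero ?_) _
      rw [← intervalIntegral.integral_of_le ht.le,
        integral_rpow_mul_sub_rpow (hpos k) (sub_pos.2 hα1) ht]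
      have := Real.Gamma_pos_of_pos (hpos k)
      have : 0 < Real.Gamma (α * (k + 1 : ℕ) + (1 - α)) :=
        Real.Gamma_pos_of_pos (by linarith [hpos k])
      positivity
  have hsum : HasSum (fun k => ∫ τ in Ioc 0 t, F k τ)
      (Real.Gamma (1 - α) * (l * mittagLeffler α (l * t ^ α))) := by
    rw [← hasSum_nat_add_iff' 1]
    simp only [← intervalIntegral.integral_of_le ht.le, hF_integral, Finset.range_one,
      Finset.sum_singleton, hF0, intervalIntegral.integral_zero, sub_zero]
    exact ((summable_mittagLeffler hα0 _).hasSum.mul_left _).mul_left _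
  have hnorm : ∀ k, ∫ τ in Ioc 0 t, ‖F k τ‖ = ∫ τ in Ioc 0 t, F k τ := fun k =>
    setIntegral_congr_fun measurableSet_Ioc fun τ hτ => Real.norm_of_nonneg (hFnonneg k τ hτ)
  have hmain := hasSum_integral_of_summable_integral_norm hFint
    (hsum.summable.congr fun k => (hnorm k).symm)
  have hcongr : ∫ τ in Ioc 0 t, (t - τ) ^ (-α) * deriv (fun τ => mittagLeffler α (l * τ ^ α)) τ =
      ∫ τ in Ioc 0 t, ∑' k, F k τ :=
    setIntegral_congr_fun measurableSet_Ioc fun τ hτ => by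
      simp only [hF, (hasDerivAt_mittagLeffler_const_mul_rpow hα0 hτ.1).deriv, tsum_mul_left]
  rw [caputoD, intervalIntegral.integral_of_le ht.le, hcongr, hmain.unique hsum]
  field_simp

theorem caputoD_const_mul_add {α t : ℝ} {φ ψ : ℝ → ℝ} {a b : ℝ} (h : ∀ τ, ψ τ = a * φ τ + b) :
    caputoD α ψ t = a * caputoD α φ t := by
  simp only [caputoD, funext h, deriv_add_const', deriv_const_mul_field, mul_left_comm _ a,
    intervalIntegral.integral_const_mul]

theorem deriv_deriv_barrierW (α A μ ε t₀ c M x t : ℝ) :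
    deriv (deriv fun x' => barrierW α A μ ε t₀ c M x' t) x =
      -(ε * Real.exp (-μ * (x - c)) *
        (mittagLeffler α (μ * A * t ^ α) / mittagLeffler α (μ * A * t₀ ^ α)) * μ ^ 2) := by
  have hexp : ∀ y, HasDerivAt (fun y => Real.exp (-μ * (y - c)))
      (Real.exp (-μ * (y - c)) * (-μ)) y := fun y => by
    simpa using (((hasDerivAt_id y).sub_const c).const_mul (-μ)).exp
  have h1 : (deriv fun x' => barrierW α A μ ε t₀ c M x' t) = fun y =>
      ε * (mittagLeffler α (μ * A * t ^ α) / mittagLeffler α (μ * A * t₀ ^ α)) * μ *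
        Real.exp (-μ * (y - c)) := by
    ext y
    refine (((((hexp y).mul_const _).const_sub 1).const_mul ε).add_const M).deriv.trans ?_
    ring
  rw [h1, ((hexp x).const_mul _).deriv]
  ring


/-- With `μ = A + 1`, the barrier `w` is a strict supersolution:
`L^α[w](x,t) = w_xx - D^α_t w = ε exp(-μ(x-c)) (E_α(μA t^α)/E_α(μA t₀^α)) (μA - μ²) < 0`
for every `x ∈ ℝ` and `t ∈ (0,t₀]`. -/
theorem barrierW_strict_supersolution (α A μ ε t₀ c M : ℝ)
    (hα0 : 0 < α) (hα1 : α < 1) (hA : 0 < A) (hμ : μ = A + 1) (hε : 0 < ε)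
    (ht₀ : 0 < t₀) :
    ∀ x : ℝ, ∀ t ∈ Set.Ioc (0:ℝ) t₀,
      deriv (deriv fun x' => barrierW α A μ ε t₀ c M x' t) x
          - caputoD α (barrierW α A μ ε t₀ c M x) t
        = ε * Real.exp (-μ * (x - c)) *
            (mittagLeffler α (μ * A * t ^ α) / mittagLeffler α (μ * A * t₀ ^ α)) *
            (μ * A - μ ^ 2) ∧
      ε * Real.exp (-μ * (x - c)) *
          (mittagLeffler α (μ * A * t ^ α) / mittagLeffler α (μ * A * t₀ ^ α)) *
          (μ * A - μ ^ 2) < 0 := by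
  intro x t ht
  have hμ0 : 0 < μ := by linarith
  have hE : ∀ s : ℝ, 0 ≤ s → 0 < mittagLeffler α (μ * A * s ^ α) := fun s hs =>
    mittagLeffler_pos hα0 (by positivity)
  refine ⟨?_, mul_neg_of_pos_of_neg ?_ ?_⟩
  · rw [deriv_deriv_barrierW, caputoD_const_mul_add
      (φ := fun τ => mittagLeffler α (μ * A * τ ^ α))
      (a := -(ε * Real.exp (-μ * (x - c)) / mittagLeffler α (μ * A * t₀ ^ α))) (b := ε + M)
      (fun τ => by rw [barrierW]; ring),
      caputoD_mittagLeffler hα0 hα1 (by positivity) ht.1]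
    ring
  · have := hE t ht.1.le
    have := hE t₀ ht₀.le
    positivity
  · rw [hμ]
    nlinarith
end

section
/- Let 0<α<1 and let B, C be real constants. Define u(x,t) = B + (C-B)/(1 - W(-1; -α/2; 1)) · [1 - W(-x t^{-α/2}; -α/2; 1)] for 0<x<t^{α/2}, t>0, where W is the Wright function. Then u satisfies the fractional diffusion equation D^α_t u(x,t) = u_xx(x,t) for 0<x<t^{α/2}, 0<t≤T, together with the boundary conditions u(0,t) = B and u(t^{α/2},t) = C for 0<t≤T. -/
open MeasureTheory Set Filter

/-- The Wright function `W(z; ρ; β) = Σ_{k≥0} z^k / (k! Γ(ρk+β))`. -/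
noncomputable def wrightF (z ρ β : ℝ) : ℝ :=
  ∑' k : ℕ, z ^ k / ((k.factorial : ℝ) * Real.Gamma (ρ * k + β))

/-- The explicit solution
`u(x,t) = B + (C-B)/(1 - W(-1;-α/2;1)) [1 - W(-x t^(-α/2); -α/2; 1)]`. -/
noncomputable def uWright (α B C x t : ℝ) : ℝ :=
  B + (C - B) / (1 - wrightF (-1) (-(α / 2)) 1) *
    (1 - wrightF (-(x * t ^ (-(α / 2)))) (-(α / 2)) 1)

open Real in
lemma inv_Gamma_eq {s : ℝ} (hs : s < 1) :
    (Real.Gamma s)⁻¹ = Real.Gamma (1 - s) * Real.sin (π * s) / π := by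
  have h := Real.Gamma_mul_Gamma_one_sub s
  have hp : 0 < Real.Gamma (1 - s) := Real.Gamma_pos_of_pos (by linarith)
  by_cases h0 : Real.sin (π * s) = 0
  · rw [h0, div_zero, mul_eq_zero] at h
    rcases h with h | h
    · simp [h, h0]
    · exact absurd h hp.ne'
  · have : Real.Gamma s = π / Real.sin (π * s) / Real.Gamma (1 - s) := by
      rw [← h]; field_simp
    rw [this]
    have := Real.pi_ne_zero
    field_simp

lemma summable_pow_div_factorial_mul_Gamma {ν b y : ℝ} (h0 : 0 < ν) (h1 : ν < 1) (hb : 0 < b)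
    (hy : 0 ≤ y) :
    Summable fun k : ℕ => y ^ k / (k.factorial : ℝ) * Real.Gamma (ν * k + b) := by
  have hpos : ∀ k : ℕ, 0 < ν * k + b := fun k => by positivity
  have hG : ∀ k : ℕ, Real.Gamma (ν * (k + 1 : ℕ) + b)
      ≤ Real.Gamma (ν * k + b) * (ν * k + b) ^ ν := by
    intro k
    have hs := hpos k
    have h := Real.Gamma_mul_add_mul_le_rpow_Gamma_mul_rpow_Gamma hs (by linarith :
      0 < ν * k + b + 1) (sub_pos.2 h1) h0 (by ring)
    rw [Real.Gamma_add_one hs.ne', Real.mul_rpow hs.le (Real.Gamma_pos_of_pos hs).le] at h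
    have e : (1 - ν) * (ν * k + b) + ν * (ν * k + b + 1) = ν * (k + 1 : ℕ) + b := by
      push_cast; ring
    rw [e] at h
    refine h.trans (le_of_eq ?_)
    rw [mul_left_comm, ← Real.rpow_add (Real.Gamma_pos_of_pos hs)]
    simp [mul_comm]
  have hlim : Tendsto (fun k : ℕ => y * ((ν + b) ^ ν * ((k + 1 : ℕ) : ℝ) ^ (-(1 - ν)))) atTop
      (nhds (y * ((ν + b) ^ ν * 0))) :=
    ((((tendsto_rpow_neg_atTop (sub_pos.2 h1)).comp tendsto_natCast_atTop_atTop).comp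
      (tendsto_add_atTop_nat 1)).const_mul _).const_mul _
  rw [mul_zero, mul_zero] at hlim
  refine summable_of_ratio_norm_eventually_le (r := 1 / 2) (by norm_num) ?_
  filter_upwards [hlim.eventually_le_const (by norm_num : (0 : ℝ) < 1 / 2)] with k hk
  have hGk := Real.Gamma_pos_of_pos (hpos k)
  have hGk1 := Real.Gamma_pos_of_pos (hpos (k + 1))
  rw [Real.norm_of_nonneg (by positivity), Real.norm_of_nonneg (by positivity)]
  have hk1 : (0 : ℝ) < (k + 1 : ℕ) := by positivity
  have hle : (ν * k + b) ^ ν ≤ (ν + b) ^ ν * ((k + 1 : ℕ) : ℝ) ^ ν := by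
    rw [← Real.mul_rpow (by positivity) hk1.le]
    apply Real.rpow_le_rpow (hpos k).le _ h0.le
    push_cast
    nlinarith [mul_nonneg hb.le (Nat.cast_nonneg (α := ℝ) k)]
  have hsplit : ((k + 1 : ℕ) : ℝ) ^ (-(1 - ν)) = ((k + 1 : ℕ) : ℝ) ^ ν / (k + 1 : ℕ) := by
    rw [neg_sub, Real.rpow_sub_one hk1.ne']
  rw [hsplit] at hk
  calc y ^ (k + 1) / ((k + 1).factorial : ℝ) * Real.Gamma (ν * (k + 1 : ℕ) + b)
      ≤ y ^ (k + 1) / ((k + 1).factorial : ℝ) *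
        (Real.Gamma (ν * k + b) * ((ν + b) ^ ν * ((k + 1 : ℕ) : ℝ) ^ ν)) := by
        gcongr
        exact (hG k).trans (by gcongr)
    _ = (y * ((ν + b) ^ ν * (((k + 1 : ℕ) : ℝ) ^ ν / (k + 1 : ℕ)))) *
        (y ^ k / (k.factorial : ℝ) * Real.Gamma (ν * k + b)) := by
        rw [Nat.factorial_succ, Nat.cast_mul, pow_succ]
        field_simp
    _ ≤ _ := by gcongr

lemma summable_wrightF {ν β : ℝ} (z : ℝ) (h0 : 0 < ν) (h1 : ν < 1) (hβ : β < 1) :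
    Summable fun k : ℕ => z ^ k / ((k.factorial : ℝ) * Real.Gamma (-ν * k + β)) := by
  refine Summable.of_norm_bounded
    ((summable_pow_div_factorial_mul_Gamma h0 h1 (sub_pos.2 hβ) (abs_nonneg z)).mul_right
      (1 / Real.pi)) fun k => ?_
  have hk : -ν * k + β < 1 := by
    have : 0 ≤ ν * k := by positivity
    linarith
  have e : 1 - (-ν * k + β) = ν * k + (1 - β) := by ring
  have hG : 0 < Real.Gamma (ν * k + (1 - β)) := by
    rw [← e]; exact Real.Gamma_pos_of_pos (by linarith)
  rw [← div_div, div_eq_mul_inv _ (Real.Gamma _), inv_Gamma_eq hk, e, norm_mul, norm_div, norm_pow,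
    Real.norm_eq_abs, Real.norm_natCast, norm_div, norm_mul, Real.norm_of_nonneg hG.le,
    Real.norm_of_nonneg Real.pi_pos.le, mul_assoc, mul_one_div]
  have := Real.pi_pos
  gcongr
  exact mul_le_of_le_one_right hG.le (Real.abs_sin_le_one _)

lemma wrightF_zero (ρ β : ℝ) : wrightF 0 ρ β = (Real.Gamma β)⁻¹ := by
  rw [wrightF, tsum_eq_single 0]
  · simp
  · intro k hk
    simp [hk]

lemma summable_wrightF_shift {ν β : ℝ} (z : ℝ) (h0 : 0 < ν) (h1 : ν < 1) (hβ : β < 1 + ν) :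
    Summable fun k : ℕ => z ^ k / ((k.factorial : ℝ) * Real.Gamma (-ν * k + (β - ν))) :=
  summable_wrightF z h0 h1 (by linarith)

lemma wrightF_term_deriv (ν β z : ℝ) (k : ℕ) :
    ((k + 1 : ℕ) : ℝ) * z ^ k / (((k + 1).factorial : ℝ) * Real.Gamma (-ν * (k + 1 : ℕ) + β))
      = z ^ k / ((k.factorial : ℝ) * Real.Gamma (-ν * k + (β - ν))) := by
  have e : -ν * ((k + 1 : ℕ) : ℝ) + β = -ν * k + (β - ν) := by push_cast; ring
  have hk1 : ((k + 1 : ℕ) : ℝ) ≠ 0 := by positivity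
  rw [e, Nat.factorial_succ, Nat.cast_mul, mul_assoc, mul_div_mul_left _ _ hk1]

lemma hasDerivAt_wrightF {ν β : ℝ} (z : ℝ) (h0 : 0 < ν) (h1 : ν < 1) (hβ : β < 1 + ν) :
    HasDerivAt (fun z => wrightF z (-ν) β) (wrightF z (-ν) (β - ν)) z := by
  set R : ℝ := |z| + 1 with hR
  have hR0 : 0 < R := by positivity
  set g' : ℕ → ℝ → ℝ := fun k y =>
    (k : ℝ) * y ^ (k - 1) / ((k.factorial : ℝ) * Real.Gamma (-ν * k + β)) with hg'
  have hs : ∀ y, Summable fun k => g' k y := fun y => by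
    rw [← summable_nat_add_iff 1]
    refine (summable_wrightF_shift y h0 h1 hβ).congr fun k => ?_
    rw [← wrightF_term_deriv]; simp [hg']
  have key := hasDerivAt_tsum_of_isPreconnected (t := Metric.ball (0 : ℝ) R) (y₀ := 0) (y := z)
    (g := fun (k : ℕ) y => y ^ k / ((k.factorial : ℝ) * Real.Gamma (-ν * k + β))) (g' := g')
    (hs R).norm Metric.isOpen_ball (convex_ball 0 R).isPreconnected
    (fun k y _ => (hasDerivAt_pow k y).div_const _) ?_ (by simpa using hR0) ?_ (by simp [hR])
  · have e : wrightF z (-ν) (β - ν) = ∑' k, g' k z := ?_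
    · rw [e]; exact key
    rw [(hs z).tsum_eq_zero_add, wrightF]
    simp only [hg', Nat.cast_zero, zero_mul, zero_div, zero_add]
    refine tsum_congr fun k => ?_
    rw [← wrightF_term_deriv]; simp
  · intro k y hy
    have hy' : |y| ≤ R := by simpa using (mem_ball_zero_iff.1 hy).le
    simp only [hg', norm_div, norm_mul, norm_pow, Real.norm_eq_abs, abs_of_pos hR0]
    gcongr
  · refine summable_of_ne_finset_zero (s := {0}) fun k hk => ?_
    simp at hk
    simp [hk]

lemma mul_wrightF_one_sub {ν : ℝ} (z : ℝ) (h0 : 0 < ν) (h1 : ν < 1) :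
    -ν * z * wrightF z (-ν) (1 - ν) = wrightF z (-ν) 0 := by
  have hs := summable_wrightF z h0 h1 zero_lt_one
  rw [wrightF, wrightF, hs.tsum_eq_zero_add, ← tsum_mul_left]
  simp only [Nat.cast_zero, mul_zero, add_zero, Real.Gamma_zero, div_zero, zero_add]
  refine tsum_congr fun k => ?_
  rw [← wrightF_term_deriv]
  have hne : -ν * ((k + 1 : ℕ) : ℝ) ≠ 0 := mul_ne_zero (neg_ne_zero.2 h0.ne') (by positivity)
  rw [Real.Gamma_add_one hne, pow_succ]
  rw [← mul_assoc, mul_comm _ (-ν * ((k + 1 : ℕ) : ℝ)), mul_assoc (-ν * _), ← div_div]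
  have hk1 : ((k + 1 : ℕ) : ℝ) ≠ 0 := by positivity
  have hν := h0.ne'
  have e : ((k + 1 : ℕ) : ℝ) * z ^ k / (-ν * ((k + 1 : ℕ) : ℝ)) = z ^ k / -ν := by
    field_simp
  rw [e, mul_div_assoc']
  congr 1
  field_simp

lemma integrableOn_rpow_mul_exp_neg_mul {s t : ℝ} (hs : -1 < s) (ht : 0 < t) :
    IntegrableOn (fun r : ℝ => r ^ s * Real.exp (-(t * r))) (Ioi 0) := by
  simpa using integrableOn_rpow_mul_exp_neg_mul_rpow hs one_pos ht

lemma hasSum_im_exp_mul_exp (θ φ y : ℝ) :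
    HasSum (fun k : ℕ => y ^ k / (k.factorial : ℝ) * Real.sin (θ + φ * k))
      (Complex.exp (θ * Complex.I) * Complex.exp (y * Complex.exp (φ * Complex.I))).im := by
  have h := (NormedSpace.expSeries_div_hasSum_exp
    ((y : ℂ) * Complex.exp (φ * Complex.I))).mul_left (Complex.exp (θ * Complex.I))
  rw [← Complex.exp_eq_exp_ℂ] at h
  refine (Complex.hasSum_im h).congr_fun fun k => ?_
  have e : Complex.exp (θ * Complex.I) *
      ((↑y * Complex.exp (φ * Complex.I)) ^ k / (k.factorial : ℂ)) =
      ((y ^ k / (k.factorial : ℝ) : ℝ) : ℂ) * Complex.exp (((θ + φ * k : ℝ) : ℂ) * Complex.I) := by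
    rw [mul_pow, ← Complex.exp_nat_mul]
    push_cast
    rw [add_mul, Complex.exp_add, show (k : ℂ) * (φ * Complex.I) = φ * k * Complex.I by ring]
    ring
  rw [e, Complex.im_ofReal_mul, Complex.exp_ofReal_mul_I_im]

lemma rpow_mul_wrightF_eq_integral {ν β t : ℝ} (x : ℝ) (h0 : 0 < ν) (h1 : ν < 1) (hβ : β < 1)
    (ht : 0 < t) :
    t ^ (β - 1) * wrightF (-(x * t ^ (-ν))) (-ν) β =
      (1 / Real.pi) * ∫ r in Ioi (0 : ℝ), r ^ (-β) * Real.exp (-(t * r)) *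
        (Complex.exp ((Real.pi * β : ℝ) * Complex.I) * Complex.exp ((-(x * r ^ ν) : ℝ) *
          Complex.exp ((-(Real.pi * ν) : ℝ) * Complex.I))).im := by
  set c : ℕ → ℝ := fun k =>
    (-x) ^ k / (k.factorial : ℝ) * Real.sin (Real.pi * β + -(Real.pi * ν) * k) with hc
  set F : ℕ → ℝ → ℝ := fun k r => c k * (r ^ ((ν * k + (1 - β)) - 1) * Real.exp (-(t * r))) with hF
  have hpos : ∀ k : ℕ, 0 < ν * k + (1 - β) := fun k => by
    have : 0 ≤ ν * k := by positivity
    linarith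
  have hFi : ∀ k, IntegrableOn (F k) (Ioi 0) := fun k =>
    (integrableOn_rpow_mul_exp_neg_mul (by linarith [hpos k]) ht).const_mul _
  have hval : ∀ k : ℕ, ∫ r in Ioi (0 : ℝ), r ^ ((ν * k + (1 - β)) - 1) * Real.exp (-(t * r)) =
      t ^ (β - 1) * ((t ^ (-ν)) ^ k * Real.Gamma (ν * k + (1 - β))) := fun k => by
    rw [Real.integral_rpow_mul_exp_neg_mul_Ioi (hpos k) ht, one_div, ← Real.rpow_neg_one,
      ← Real.rpow_mul ht.le, ← Real.rpow_natCast, ← Real.rpow_mul ht.le, ← mul_assoc,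
      ← Real.rpow_add ht]
    ring_nf
  have hnorm : Summable fun k => ∫ r in Ioi (0 : ℝ), ‖F k r‖ := by
    refine Summable.of_nonneg_of_le (fun k => integral_nonneg fun r => norm_nonneg _) (fun k => ?_)
      ((summable_pow_div_factorial_mul_Gamma h0 h1 (sub_pos.2 hβ)
        (by positivity : 0 ≤ |x| * t ^ (-ν))).mul_left (t ^ (β - 1)))
    have e : ∫ r in Ioi (0 : ℝ), ‖F k r‖ = ∫ r in Ioi (0 : ℝ),
        |c k| * (r ^ ((ν * k + (1 - β)) - 1) * Real.exp (-(t * r))) := by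
      refine setIntegral_congr_fun measurableSet_Ioi fun r hr => ?_
      have hr : 0 < r := hr
      simp only [hF, norm_mul, Real.norm_eq_abs]
      rw [abs_of_nonneg (Real.rpow_nonneg hr.le _), abs_of_pos (Real.exp_pos _)]
    rw [e, integral_const_mul, hval]
    have hck : |c k| ≤ |x| ^ k / (k.factorial : ℝ) := by
      simp only [hc, abs_mul, abs_div, abs_pow, abs_neg, Nat.abs_cast]
      exact mul_le_of_le_one_right (by positivity) (Real.abs_sin_le_one _)
    have hG := (Real.Gamma_pos_of_pos (hpos k)).le
    calc _ ≤ |x| ^ k / (k.factorial : ℝ) *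
          (t ^ (β - 1) * ((t ^ (-ν)) ^ k * Real.Gamma (ν * k + (1 - β)))) := by gcongr
      _ = _ := by rw [mul_pow]; ring
  have key := (hasSum_integral_of_summable_integral_norm hFi hnorm).tsum_eq
  have hR : ∫ r in Ioi (0 : ℝ), ∑' k, F k r = ∫ r in Ioi (0 : ℝ), r ^ (-β) * Real.exp (-(t * r)) *
        (Complex.exp ((Real.pi * β : ℝ) * Complex.I) * Complex.exp ((-(x * r ^ ν) : ℝ) *
          Complex.exp ((-(Real.pi * ν) : ℝ) * Complex.I))).im := by
    refine setIntegral_congr_fun measurableSet_Ioi fun r hr => ?_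
    have hr : 0 < r := hr
    rw [← ((hasSum_im_exp_mul_exp (Real.pi * β) (-(Real.pi * ν)) (-(x * r ^ ν))).mul_left
      (r ^ (-β) * Real.exp (-(t * r)))).tsum_eq]
    refine tsum_congr fun k => ?_
    have e : r ^ ((ν * k + (1 - β)) - 1) = r ^ (-β) * (r ^ ν) ^ k := by
      rw [← Real.rpow_natCast, ← Real.rpow_mul hr.le, ← Real.rpow_add hr]
      ring_nf
    simp only [hF, hc]
    rw [e, ← neg_mul x, mul_pow]
    ring
  rw [← hR, ← key, wrightF, ← tsum_mul_left, ← tsum_mul_left]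
  refine tsum_congr fun k => ?_
  simp only [hF]
  rw [integral_const_mul, hval, ← div_div, div_eq_mul_inv _ (Real.Gamma _),
    inv_Gamma_eq (by linarith [hpos k]), ← neg_mul x, mul_pow]
  have e1 : 1 - (-ν * k + β) = ν * k + (1 - β) := by ring
  have e2 : Real.pi * (-ν * k + β) = Real.pi * β + -(Real.pi * ν) * k := by ring
  rw [e1, e2]
  simp only [hc]
  ring

lemma norm_ofReal_cpow_of_re_eq {r : ℝ} (hr : 0 < r) {z : ℂ} {a : ℝ} (hz : z.re = a) :
    ‖(r : ℂ) ^ z‖ = r ^ a := by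
  rw [Complex.norm_cpow_eq_rpow_re_of_pos hr, hz]

lemma measurable_ofReal_cpow (z : ℂ) : Measurable fun r : ℝ => (r : ℂ) ^ z :=
  Complex.measurable_ofReal.pow_const z

lemma integrableOn_cpow_mul_cexp {s z : ℂ} (hs : 0 < s.re) (hz : 0 < z.re) :
    IntegrableOn (fun x : ℝ => (x : ℂ) ^ (s - 1) * Complex.exp (-(z * x))) (Ioi 0) := by
  refine Integrable.mono' (integrableOn_rpow_mul_exp_neg_mul
    (by linarith : -1 < s.re - 1) hz) ?_ ?_
  · exact ((measurable_ofReal_cpow _).mul (by fun_prop)).aestronglyMeasurable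
  · filter_upwards [ae_restrict_mem measurableSet_Ioi] with x hx
    rw [norm_mul, norm_ofReal_cpow_of_re_eq hx (a := s.re - 1) (by simp), Complex.norm_exp]
    simp

lemma differentiableOn_integral_cpow_mul_cexp {s : ℂ} (hs : 0 < s.re) :
    DifferentiableOn ℂ (fun z : ℂ => ∫ x in Ioi (0 : ℝ), (x : ℂ) ^ (s - 1) *
      Complex.exp (-(z * x))) {z | 0 < z.re} := by
  intro z hz
  have hz : 0 < z.re := hz
  refine (hasDerivAt_integral_of_dominated_loc_of_deriv_le (s := Metric.ball z (z.re / 2))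
    (μ := volume.restrict (Ioi 0))
    (F := fun (z : ℂ) (x : ℝ) => (x : ℂ) ^ (s - 1) * Complex.exp (-(z * x)))
    (F' := fun (z : ℂ) (x : ℝ) => (x : ℂ) ^ (s - 1) * (Complex.exp (-(z * x)) * (-x)))
    (bound := fun x => x ^ s.re * Real.exp (-(z.re / 2 * x)))
    (Metric.ball_mem_nhds z (half_pos hz)) (Eventually.of_forall fun w => ?_)
    (integrableOn_cpow_mul_cexp hs hz) ?_ ?_
    (integrableOn_rpow_mul_exp_neg_mul (by linarith) (half_pos hz)) ?_).2.differentiableAt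
    |>.differentiableWithinAt
  · exact ((measurable_ofReal_cpow _).mul (by fun_prop)).aestronglyMeasurable
  · exact ((measurable_ofReal_cpow _).mul (by fun_prop)).aestronglyMeasurable
  · filter_upwards [ae_restrict_mem measurableSet_Ioi] with x hx w hw
    have hx : 0 < x := hx
    have hw : z.re / 2 ≤ w.re := by
      have h1 := (Complex.abs_re_le_norm (w - z)).trans (mem_ball_iff_norm.1 hw).le
      rw [Complex.sub_re] at h1
      linarith [(abs_le.1 h1).1]
    rw [norm_mul, norm_mul, norm_ofReal_cpow_of_re_eq hx (a := s.re - 1) (by simp),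
      Complex.norm_exp, norm_neg, Complex.norm_real, Real.norm_of_nonneg hx.le,
      Real.rpow_sub_one hx.ne']
    have e : x ^ s.re / x * (Real.exp (-(w * x)).re * x) = x ^ s.re * Real.exp (-(w * x)).re := by
      field_simp
    rw [e]
    have : (-(w * x)).re = -(w.re * x) := by simp
    rw [this]
    gcongr
  · refine Eventually.of_forall fun x w _ => HasDerivAt.const_mul _ ?_
    have h := ((hasDerivAt_id w).mul_const (x : ℂ)).neg.cexp
    simpa using h

lemma integral_cpow_mul_cexp {s z : ℂ} (hs : 0 < s.re) (hz : 0 < z.re) :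
    ∫ x in Ioi (0 : ℝ), (x : ℂ) ^ (s - 1) * Complex.exp (-(z * x)) =
      (1 / z) ^ s * Complex.Gamma s := by
  have hU : IsOpen {z : ℂ | 0 < z.re} := isOpen_lt continuous_const Complex.continuous_re
  have hf := (differentiableOn_integral_cpow_mul_cexp hs).analyticOnNhd hU
  have hg : DifferentiableOn ℂ (fun z : ℂ => (1 / z) ^ s * Complex.Gamma s) {z | 0 < z.re} := by
    intro w hw
    have hw : 0 < w.re := hw
    have hw0 : w ≠ 0 := fun h => by simp [h] at hw
    have hsl : 1 / w ∈ Complex.slitPlane := by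
      left
      rw [one_div, Complex.inv_re]
      exact div_pos hw (Complex.normSq_pos.2 hw0)
    have hd : DifferentiableAt ℂ (fun z : ℂ => 1 / z) w :=
      (differentiableAt_const _).div differentiableAt_id hw0
    exact ((hd.cpow_const hsl).mul_const _).differentiableWithinAt
  refine hf.eqOn_of_preconnected_of_frequently_eq (hg.analyticOnNhd hU) (z₀ := 1)
    (convex_halfSpace_re_gt 0).isPreconnected (by simp) ?_ hz
  have ht : Tendsto (fun n : ℕ => (((1 : ℝ) + 1 / ((n : ℝ) + 1) : ℝ) : ℂ)) atTop
      (nhdsWithin 1 {1}ᶜ) := by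
    refine tendsto_nhdsWithin_iff.2 ⟨?_, Eventually.of_forall fun n => ?_⟩
    · have := (tendsto_one_div_add_atTop_nhds_zero_nat (𝕜 := ℝ)).const_add 1
      rw [add_zero] at this
      simpa [Function.comp_def] using (Complex.continuous_ofReal.tendsto 1).comp this
    · simp only [mem_compl_iff, mem_singleton_iff, Complex.ofReal_eq_one]
      have : (0 : ℝ) < 1 / ((n : ℝ) + 1) := by positivity
      linarith
  refine ht.frequently (Frequently.of_forall fun n => ?_)
  exact Complex.integral_cpow_mul_exp_neg_mul_Ioi hs (by positivity)

lemma integrableOn_cpow_mul {ν : ℝ} {h : ℝ → ℂ} {s : ℂ} (hs : s.re = 1)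
    (hi : IntegrableOn (fun r => ((r ^ (-ν) : ℝ) : ℂ) * h r) (Ioi 0)) :
    IntegrableOn (fun r : ℝ => (r : ℂ) ^ (-(ν * s)) * h r) (Ioi 0) := by
  have hm : AEStronglyMeasurable (fun r : ℝ => (r : ℂ) ^ (-(ν * s) + ν) *
      (((r ^ (-ν) : ℝ) : ℂ) * h r)) (volume.restrict (Ioi 0)) :=
    (measurable_ofReal_cpow _).aestronglyMeasurable.mul hi.aestronglyMeasurable
  refine Integrable.congr (Integrable.mono hi hm ?_) ?_
  · filter_upwards [ae_restrict_mem measurableSet_Ioi] with r hr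
    rw [norm_mul, norm_ofReal_cpow_of_re_eq hr (a := 0) (by simp [hs])]
    simp
  · filter_upwards [ae_restrict_mem measurableSet_Ioi] with r hr
    have hr : 0 < r := hr
    have hr0 : (r : ℂ) ≠ 0 := Complex.ofReal_ne_zero.2 hr.ne'
    rw [Complex.ofReal_cpow hr.le, ← mul_assoc, ← Complex.cpow_add _ _ hr0]
    simp

lemma aestronglyMeasurable_of_integrableOn_rpow_mul {ν : ℝ} {h : ℝ → ℂ}
    (hi : IntegrableOn (fun r => ((r ^ (-ν) : ℝ) : ℂ) * h r) (Ioi 0)) :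
    AEStronglyMeasurable h (volume.restrict (Ioi 0)) := by
  have hm : AEStronglyMeasurable (fun r : ℝ => ((r ^ ν : ℝ) : ℂ) * (((r ^ (-ν) : ℝ) : ℂ) * h r))
      (volume.restrict (Ioi 0)) :=
    (Complex.measurable_ofReal.comp (measurable_id.pow_const ν)).aestronglyMeasurable.mul
      hi.aestronglyMeasurable
  refine hm.congr ?_
  filter_upwards [ae_restrict_mem measurableSet_Ioi] with r hr
  have hr : 0 < r := hr
  rw [← mul_assoc, ← Complex.ofReal_mul, ← Real.rpow_add hr]
  simp

/-- The function `x ↦ ∫₀^∞ exp(-x r^ν e^{iθ}) h(r) dr`. -/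
noncomputable def expRpowTransform (ν θ : ℝ) (h : ℝ → ℂ) (x : ℝ) : ℂ :=
  ∫ r in Ioi (0 : ℝ), Complex.exp ((-(x * r ^ ν) : ℝ) * Complex.exp (θ * Complex.I)) * h r

lemma norm_exp_ofReal_mul_exp (y θ : ℝ) :
    ‖Complex.exp ((y : ℝ) * Complex.exp (θ * Complex.I))‖ = Real.exp (y * Real.cos θ) := by
  rw [Complex.norm_exp, Complex.re_ofReal_mul, Complex.exp_ofReal_mul_I_re]

lemma measurable_exp_rpow (ν θ : ℝ) :
    Measurable fun p : ℝ × ℝ =>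
      Complex.exp ((-(p.1 * p.2 ^ ν) : ℝ) * Complex.exp (θ * Complex.I)) := by
  fun_prop

lemma exp_neg_rpow_le {ν x r c : ℝ} (hx : 0 < x) (hr : 0 < r) (hc : 0 < c) :
    Real.exp (-(x * r ^ ν) * c) ≤ (x * c)⁻¹ * r ^ (-ν) := by
  have hp : 0 < r ^ ν := Real.rpow_pos_of_pos hr ν
  rw [Real.rpow_neg hr.le, ← mul_inv, neg_mul, Real.exp_neg]
  apply inv_anti₀ (by positivity)
  have := Real.add_one_le_exp (x * r ^ ν * c)
  nlinarith

lemma norm_exp_rpow_mul_le {ν θ x a r : ℝ} {z : ℂ} (ha : 0 < a) (hax : a ≤ x) (hr : 0 < r)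
    (hθ : 0 < Real.cos θ) :
    ‖Complex.exp ((-(x * r ^ ν) : ℝ) * Complex.exp (θ * Complex.I)) * z‖ ≤
      (a * Real.cos θ)⁻¹ * ‖((r ^ (-ν) : ℝ) : ℂ) * z‖ := by
  have hp : 0 < r ^ (-ν) := Real.rpow_pos_of_pos hr _
  rw [norm_mul, norm_mul, norm_exp_ofReal_mul_exp, Complex.norm_real, Real.norm_of_nonneg hp.le,
    ← mul_assoc]
  gcongr
  refine (exp_neg_rpow_le (lt_of_lt_of_le ha hax) hr hθ).trans ?_
  gcongr

lemma integrableOn_exp_rpow_mul {ν θ x : ℝ} {h : ℝ → ℂ} (hx : 0 < x) (hθ : 0 < Real.cos θ)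
    (hi : IntegrableOn (fun r => ((r ^ (-ν) : ℝ) : ℂ) * h r) (Ioi 0)) :
    IntegrableOn (fun r : ℝ =>
      Complex.exp ((-(x * r ^ ν) : ℝ) * Complex.exp (θ * Complex.I)) * h r) (Ioi 0) := by
  refine Integrable.mono' (hi.norm.const_mul (x * Real.cos θ)⁻¹)
    (((measurable_exp_rpow ν θ).comp measurable_prodMk_left).aestronglyMeasurable.mul
      (aestronglyMeasurable_of_integrableOn_rpow_mul hi)) ?_
  filter_upwards [ae_restrict_mem measurableSet_Ioi] with r hr
  exact norm_exp_rpow_mul_le hx le_rfl hr hθ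

lemma continuousAt_expRpowTransform {ν θ x : ℝ} {h : ℝ → ℂ} (hx : 0 < x) (hθ : 0 < Real.cos θ)
    (hi : IntegrableOn (fun r => ((r ^ (-ν) : ℝ) : ℂ) * h r) (Ioi 0)) :
    ContinuousAt (expRpowTransform ν θ h) x := by
  refine continuousAt_of_dominated
    (bound := fun r => (x / 2 * Real.cos θ)⁻¹ * ‖((r ^ (-ν) : ℝ) : ℂ) * h r‖)
    (Eventually.of_forall fun y =>
      ((measurable_exp_rpow ν θ).comp measurable_prodMk_left).aestronglyMeasurable.mul
      (aestronglyMeasurable_of_integrableOn_rpow_mul hi)) ?_ (hi.norm.const_mul _) ?_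
  · filter_upwards [lt_mem_nhds (half_lt_self hx)] with y hy
    filter_upwards [ae_restrict_mem measurableSet_Ioi] with r hr
    exact norm_exp_rpow_mul_le (half_pos hx) hy.le hr hθ
  · refine Eventually.of_forall fun r => ?_
    fun_prop

lemma integral_cpow_mul_exp_rpow {ν θ r : ℝ} {s : ℂ} (hs : 0 < s.re) (hθ : |θ| < Real.pi / 2)
    (hr : 0 < r) :
    ∫ x in Ioi (0 : ℝ), (x : ℂ) ^ (s - 1) *
        Complex.exp ((-(x * r ^ ν) : ℝ) * Complex.exp (θ * Complex.I)) =
      Complex.Gamma s * Complex.exp (-(θ * Complex.I * s)) * (r : ℂ) ^ (-(ν * s)) := by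
  have hθ' := abs_lt.1 hθ
  have hcos : 0 < Real.cos θ := Real.cos_pos_of_mem_Ioo hθ'
  have hr0 : (r : ℂ) ≠ 0 := Complex.ofReal_ne_zero.2 hr.ne'
  have hre : 0 < (((r ^ ν : ℝ) : ℂ) * Complex.exp (θ * Complex.I)).re := by
    rw [Complex.re_ofReal_mul, Complex.exp_ofReal_mul_I_re]
    exact mul_pos (Real.rpow_pos_of_pos hr ν) hcos
  have h := integral_cpow_mul_cexp hs hre
  have e : ∀ x : ℝ, Complex.exp ((-(x * r ^ ν) : ℝ) * Complex.exp (θ * Complex.I)) =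
      Complex.exp (-(((r ^ ν : ℝ) : ℂ) * Complex.exp (θ * Complex.I) * x)) := fun x => by
    push_cast; ring_nf
  simp only [e]
  rw [h]
  have hinv : 1 / (((r ^ ν : ℝ) : ℂ) * Complex.exp (θ * Complex.I)) =
      Complex.exp (-(ν * Real.log r : ℝ) - θ * Complex.I) := by
    rw [one_div, Real.rpow_def_of_pos hr, Complex.ofReal_exp, ← Complex.exp_add,
      ← Complex.exp_neg]
    congr 1; push_cast; ring
  have hpi := Real.pi_pos
  rw [hinv, Complex.cpow_def_of_ne_zero (Complex.exp_ne_zero _),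
    Complex.log_exp (by simp; linarith) (by simp; linarith), Complex.cpow_def_of_ne_zero hr0,
    ← Complex.ofReal_log hr.le, mul_assoc, ← Complex.exp_add, mul_comm]
  congr 2
  push_cast; ring

lemma integrable_mellin_kernel {ν θ : ℝ} {h : ℝ → ℂ} {s : ℂ} (hs : s.re = 1)
    (hθ : 0 < Real.cos θ)
    (hi : IntegrableOn (fun r => ((r ^ (-ν) : ℝ) : ℂ) * h r) (Ioi 0)) :
    Integrable (fun p : ℝ × ℝ => (p.1 : ℂ) ^ (s - 1) *
      (Complex.exp ((-(p.1 * p.2 ^ ν) : ℝ) * Complex.exp (θ * Complex.I)) * h p.2))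
      ((volume.restrict (Ioi 0)).prod (volume.restrict (Ioi 0))) := by
  have hm : AEStronglyMeasurable (fun p : ℝ × ℝ => (p.1 : ℂ) ^ (s - 1) *
      (Complex.exp ((-(p.1 * p.2 ^ ν) : ℝ) * Complex.exp (θ * Complex.I)) * h p.2))
      ((volume.restrict (Ioi 0)).prod (volume.restrict (Ioi 0))) :=
    ((measurable_ofReal_cpow _).comp measurable_fst).aestronglyMeasurable.mul
      ((measurable_exp_rpow ν θ).aestronglyMeasurable.mul
        (aestronglyMeasurable_of_integrableOn_rpow_mul hi).comp_snd)
  have hnorm : ∀ r : ℝ, ∀ x ∈ Ioi (0 : ℝ), ‖(x : ℂ) ^ (s - 1) *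
      (Complex.exp ((-(x * r ^ ν) : ℝ) * Complex.exp (θ * Complex.I)) * h r)‖ =
      Real.exp (-(r ^ ν * Real.cos θ) * x) * ‖h r‖ := fun r x hx => by
    rw [norm_mul, norm_mul, norm_exp_ofReal_mul_exp,
      norm_ofReal_cpow_of_re_eq hx (a := 0) (by simp [hs]), Real.rpow_zero, one_mul]
    ring_nf
  rw [integrable_prod_iff' hm]
  constructor
  · filter_upwards [ae_restrict_mem measurableSet_Ioi] with r hr
    have hr : 0 < r := hr
    have hb : 0 < r ^ ν * Real.cos θ := mul_pos (Real.rpow_pos_of_pos hr ν) hθ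
    refine Integrable.mono' ((exp_neg_integrableOn_Ioi 0 hb).mul_const ‖h r‖) ?_ ?_
    · exact (measurable_ofReal_cpow _).aestronglyMeasurable.mul
        (((measurable_exp_rpow ν θ).comp measurable_prodMk_right).mul_const _).aestronglyMeasurable
    · filter_upwards [ae_restrict_mem measurableSet_Ioi] with x hx
      exact (hnorm r x hx).le
  · refine (hi.norm.const_mul (Real.cos θ)⁻¹).congr ?_
    filter_upwards [ae_restrict_mem measurableSet_Ioi] with r hr
    have hr : 0 < r := hr
    have hb : 0 < r ^ ν * Real.cos θ := mul_pos (Real.rpow_pos_of_pos hr ν) hθ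
    rw [setIntegral_congr_fun measurableSet_Ioi (hnorm r), integral_mul_const,
      integral_exp_mul_Ioi (neg_lt_zero.2 hb), norm_mul, Complex.norm_real,
      Real.norm_of_nonneg (Real.rpow_nonneg hr.le _), Real.rpow_neg hr.le]
    simp only [mul_zero, Real.exp_zero]
    field_simp

lemma mellinConvergent_expRpowTransform {ν θ : ℝ} {h : ℝ → ℂ} {s : ℂ} (hs : s.re = 1)
    (hθ : 0 < Real.cos θ)
    (hi : IntegrableOn (fun r => ((r ^ (-ν) : ℝ) : ℂ) * h r) (Ioi 0)) :
    MellinConvergent (expRpowTransform ν θ h) s := by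
  refine (integrable_mellin_kernel hs hθ hi).integral_prod_left.congr ?_
  refine Eventually.of_forall fun x => ?_
  simp only [expRpowTransform, smul_eq_mul, integral_const_mul]

lemma mellin_expRpowTransform {ν θ : ℝ} {h : ℝ → ℂ} {s : ℂ} (hs : s.re = 1)
    (hθ : |θ| < Real.pi / 2)
    (hi : IntegrableOn (fun r => ((r ^ (-ν) : ℝ) : ℂ) * h r) (Ioi 0)) :
    mellin (expRpowTransform ν θ h) s = Complex.Gamma s * Complex.exp (-(θ * Complex.I * s)) *
      ∫ r in Ioi (0 : ℝ), (r : ℂ) ^ (-(ν * s)) * h r := by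
  have hcos : 0 < Real.cos θ := Real.cos_pos_of_mem_Ioo (abs_lt.1 hθ)
  have h1 := integral_integral_swap (f := fun x r : ℝ => (x : ℂ) ^ (s - 1) *
    (Complex.exp ((-(x * r ^ ν) : ℝ) * Complex.exp (θ * Complex.I)) * h r))
    (integrable_mellin_kernel hs hcos hi)
  simp only [integral_const_mul] at h1
  rw [mellin]
  simp only [smul_eq_mul, expRpowTransform]
  rw [h1, ← integral_const_mul]
  refine setIntegral_congr_fun measurableSet_Ioi fun r hr => ?_
  simp only [← mul_assoc]
  rw [integral_mul_const, integral_cpow_mul_exp_rpow (by simp [hs]) hθ hr]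

lemma integral_beta_scaled {u v : ℂ} {t : ℝ} (hu : 0 < u.re) (hv : 0 < v.re) (ht : 0 < t) :
    ∫ τ in Ioo (0 : ℝ) t, (τ : ℂ) ^ (u - 1) * ((t - τ : ℝ) : ℂ) ^ (v - 1) =
      (t : ℂ) ^ (u + v - 1) * (Complex.Gamma u * Complex.Gamma v / Complex.Gamma (u + v)) := by
  have h := Complex.betaIntegral_scaled u v ht
  rw [intervalIntegral.integral_of_le ht.le, integral_Ioc_eq_integral_Ioo] at h
  have huv : Complex.Gamma (u + v) ≠ 0 := Complex.Gamma_ne_zero_of_re_pos (by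
    rw [Complex.add_re]; positivity)
  rw [Complex.Gamma_mul_Gamma_eq_betaIntegral hu hv, mul_div_cancel_left₀ _ huv, ← h]
  simp only [Complex.ofReal_sub]

lemma integrableOn_beta_scaled {a b t : ℝ} (ha : 0 < a) (hb : 0 < b) (ht : 0 < t) :
    IntegrableOn (fun τ : ℝ => τ ^ (a - 1) * (t - τ) ^ (b - 1)) (Ioo 0 t) := by
  have hG : ∀ {c : ℝ}, 0 < c → Complex.Gamma c ≠ 0 := fun hc =>
    Complex.Gamma_ne_zero_of_re_pos (by simpa using hc)
  have hne : ∫ τ in Ioo (0 : ℝ) t, (τ : ℂ) ^ ((a : ℂ) - 1) *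
      ((t - τ : ℝ) : ℂ) ^ ((b : ℂ) - 1) ≠ 0 := by
    rw [integral_beta_scaled (by simpa using ha) (by simpa using hb) ht]
    have hab := hG (add_pos ha hb)
    push_cast at hab
    refine mul_ne_zero ?_ (div_ne_zero (mul_ne_zero (hG ha) (hG hb)) hab)
    rw [Complex.cpow_def_of_ne_zero (Complex.ofReal_ne_zero.2 ht.ne')]
    exact Complex.exp_ne_zero _
  refine (not_imp_comm.1 integral_undef hne).norm.congr ?_
  filter_upwards [ae_restrict_mem measurableSet_Ioo] with τ hτ
  rw [norm_mul, norm_ofReal_cpow_of_re_eq hτ.1 (a := a - 1) (by simp),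
    norm_ofReal_cpow_of_re_eq (sub_pos.2 hτ.2) (a := b - 1) (by simp)]

lemma integral_rpow_neg_mul_exp {ν τ : ℝ} (h1 : ν < 1) (hτ : 0 < τ) :
    ∫ r in Ioi (0 : ℝ), r ^ (-ν) * Real.exp (-(τ * r)) = τ ^ (ν - 1) * Real.Gamma (1 - ν) := by
  have h := Real.integral_rpow_mul_exp_neg_mul_Ioi (sub_pos.2 h1) hτ
  rw [one_div, Real.inv_rpow hτ.le, ← Real.rpow_neg hτ.le, neg_sub] at h
  simpa using h

lemma integrable_caputo_kernel {ν t : ℝ} (h0 : 0 < ν) (h2 : ν < 1 / 2) (ht : 0 < t) :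
    Integrable (fun p : ℝ × ℝ => p.1 ^ (-ν) * ((t - p.2) ^ (-(2 * ν)) * Real.exp (-(p.2 * p.1))))
      ((volume.restrict (Ioi 0)).prod (volume.restrict (Ioo 0 t))) := by
  have hm : Measurable fun p : ℝ × ℝ =>
      p.1 ^ (-ν) * ((t - p.2) ^ (-(2 * ν)) * Real.exp (-(p.2 * p.1))) := by fun_prop
  rw [integrable_prod_iff' hm.aestronglyMeasurable]
  constructor
  · filter_upwards [ae_restrict_mem measurableSet_Ioo] with τ hτ
    refine ((integrableOn_rpow_mul_exp_neg_mul (by linarith : -1 < -ν) hτ.1).const_mul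
      ((t - τ) ^ (-(2 * ν)))).congr (Eventually.of_forall fun r => ?_)
    ring
  · refine ((integrableOn_beta_scaled h0 (by linarith : 0 < 1 - 2 * ν) ht).mul_const
      (Real.Gamma (1 - ν))).congr ?_
    filter_upwards [ae_restrict_mem measurableSet_Ioo] with τ hτ
    have hτ' : 0 < t - τ := sub_pos.2 hτ.2
    have e : ∫ r in Ioi (0 : ℝ), ‖r ^ (-ν) * ((t - τ) ^ (-(2 * ν)) * Real.exp (-(τ * r)))‖ =
        ∫ r in Ioi (0 : ℝ), (t - τ) ^ (-(2 * ν)) * (r ^ (-ν) * Real.exp (-(τ * r))) := by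
      refine setIntegral_congr_fun measurableSet_Ioi fun r hr => ?_
      have hr : 0 < r := hr
      rw [Real.norm_of_nonneg (by positivity)]
      ring
    rw [e, integral_const_mul, integral_rpow_neg_mul_exp (by linarith) hτ.1]
    have : 1 - 2 * ν - 1 = -(2 * ν) := by ring
    rw [this]
    ring

/-- The Laplace-type kernel `∫₀ᵗ (t-τ)^{-2ν} e^{-τr} dτ`. -/
noncomputable def caputoExp (ν t r : ℝ) : ℝ :=
  ∫ τ in Ioo (0 : ℝ) t, (t - τ) ^ (-(2 * ν)) * Real.exp (-(τ * r))

lemma integrableOn_rpow_mul_caputoExp {ν t : ℝ} (h0 : 0 < ν) (h2 : ν < 1 / 2) (ht : 0 < t) :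
    IntegrableOn (fun r => r ^ (-ν) * caputoExp ν t r) (Ioi 0) := by
  refine (integrable_caputo_kernel h0 h2 ht).integral_prod_left.congr
    (Eventually.of_forall fun r => ?_)
  simp only [caputoExp, integral_const_mul]

lemma integral_cpow_mul_caputoExp {ν t : ℝ} {s : ℂ} (h0 : 0 < ν) (h2 : ν < 1 / 2) (ht : 0 < t)
    (hs : s.re = 1) :
    ∫ r in Ioi (0 : ℝ), (r : ℂ) ^ (-(ν * s)) * (caputoExp ν t r : ℂ) =
      Complex.Gamma (1 - ν * s) * ((t : ℂ) ^ (ν * s - 2 * ν) *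
        (Complex.Gamma (ν * s) * Complex.Gamma (1 - 2 * ν) /
          Complex.Gamma (ν * s + (1 - 2 * ν)))) := by
  have hK : Integrable (Function.uncurry fun r τ : ℝ => (r : ℂ) ^ (-(ν * s)) *
      (((t - τ) ^ (-(2 * ν)) * Real.exp (-(τ * r)) : ℝ) : ℂ))
      ((volume.restrict (Ioi 0)).prod (volume.restrict (Ioo 0 t))) := by
    refine Integrable.mono (integrable_caputo_kernel h0 h2 ht) ?_ ?_
    · refine Measurable.aestronglyMeasurable ?_
      exact ((measurable_ofReal_cpow _).comp measurable_fst).mul (by fun_prop)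
    · have hae : ∀ᵐ p ∂((volume.restrict (Ioi (0 : ℝ))).prod (volume.restrict (Ioo 0 t))),
          p ∈ Ioi (0 : ℝ) ×ˢ Ioo 0 t := by
        rw [Measure.prod_restrict]
        exact ae_restrict_mem (measurableSet_Ioi.prod measurableSet_Ioo)
      filter_upwards [hae] with p hp
      have hp1 : 0 < p.1 := hp.1
      simp only [Function.uncurry]
      rw [norm_mul, norm_ofReal_cpow_of_re_eq hp1 (a := -ν) (by simp [hs]), norm_mul,
        Complex.norm_real, Real.norm_of_nonneg (Real.rpow_nonneg hp1.le _)]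
  have h1 := integral_integral_swap hK
  have hsr : 0 < (1 - ν * s).re := by simp [hs]; linarith
  simp only [caputoExp]
  have e1 : ∀ r : ℝ, (r : ℂ) ^ (-(ν * s)) *
      ((∫ τ in Ioo (0 : ℝ) t, (t - τ) ^ (-(2 * ν)) * Real.exp (-(τ * r)) : ℝ) : ℂ) =
      ∫ τ in Ioo (0 : ℝ) t, (r : ℂ) ^ (-(ν * s)) *
      (((t - τ) ^ (-(2 * ν)) * Real.exp (-(τ * r)) : ℝ) : ℂ) := fun r => by
    rw [integral_const_mul, integral_complex_ofReal]
  simp only [e1]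
  rw [h1]
  have hb := integral_beta_scaled (u := ν * s) (v := 1 - 2 * ν) (t := t) (by simp [hs, h0])
    (by simp; linarith) ht
  have e2 : (ν * s + (1 - 2 * ν) - 1 : ℂ) = ν * s - 2 * ν := by ring
  rw [e2] at hb
  rw [← hb, ← integral_const_mul]
  refine setIntegral_congr_fun measurableSet_Ioo fun τ hτ => ?_
  have hτ0 : 0 < τ := hτ.1
  have hτ' : 0 < t - τ := sub_pos.2 hτ.2
  have h3 := Complex.integral_cpow_mul_exp_neg_mul_Ioi hsr hτ0
  have e3 : (1 / (τ : ℂ)) ^ (1 - ν * s) = (τ : ℂ) ^ (ν * s - 1) := by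
    rw [one_div, ← Complex.ofReal_inv, Complex.ofReal_inv, Complex.inv_cpow, ← Complex.cpow_neg,
      neg_sub]
    rw [Complex.arg_ofReal_of_nonneg hτ0.le]
    exact Real.pi_pos.ne
  rw [e3] at h3
  have e4 : ∀ r : ℝ, (r : ℂ) ^ (-(ν * s)) *
      (((t - τ) ^ (-(2 * ν)) * Real.exp (-(τ * r)) : ℝ) : ℂ) =
      ((t - τ : ℝ) : ℂ) ^ ((1 - 2 * ν : ℂ) - 1) *
        ((r : ℂ) ^ (1 - ν * s - 1) * Complex.exp (-(τ * r))) := fun r => by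
    rw [Complex.ofReal_mul, Complex.ofReal_cpow hτ'.le]
    push_cast
    rw [show (1 - 2 * ν - 1 : ℂ) = -(2 * ν) by ring, show (1 - ν * s - 1 : ℂ) = -(ν * s) by ring]
    ring
  simp only [e4]
  rw [integral_const_mul, h3]
  ring

lemma integral_cpow_mul_rpow_mul_exp {ν t : ℝ} {s : ℂ} (h0 : 0 < ν) (ht : 0 < t)
    (hs : s.re = 1) :
    ∫ r in Ioi (0 : ℝ), (r : ℂ) ^ (-(ν * s)) *
        ((r ^ (2 * ν - 1) * Real.exp (-(t * r)) : ℝ) : ℂ) =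
      (t : ℂ) ^ (ν * s - 2 * ν) * Complex.Gamma (2 * ν - ν * s) := by
  have h3 := Complex.integral_cpow_mul_exp_neg_mul_Ioi (a := 2 * ν - ν * s)
    (by simp [hs]; linarith) ht
  have e3 : (1 / (t : ℂ)) ^ (2 * ν - ν * s) = (t : ℂ) ^ (ν * s - 2 * ν) := by
    rw [one_div, Complex.inv_cpow, ← Complex.cpow_neg, neg_sub]
    rw [Complex.arg_ofReal_of_nonneg ht.le]
    exact Real.pi_pos.ne
  rw [e3] at h3
  rw [← h3]
  refine setIntegral_congr_fun measurableSet_Ioi fun r hr => ?_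
  have hr : 0 < r := hr
  rw [Complex.ofReal_mul, Complex.ofReal_cpow hr.le, ← mul_assoc,
    ← Complex.cpow_add _ _ (Complex.ofReal_ne_zero.2 hr.ne')]
  push_cast
  congr 2
  ring

/-- The difference of the Caputo kernel and the boundary value, with phase `ψ`, of
`Γ(1-2ν) s^{2ν-1} e^{st}` on the negative half-line. -/
noncomputable def caputoDefect (ν ψ t r : ℝ) : ℂ :=
  (caputoExp ν t r : ℂ) - Complex.exp (ψ * Complex.I) *
    ((Real.Gamma (1 - 2 * ν) * (r ^ (2 * ν - 1) * Real.exp (-(t * r))) : ℝ) : ℂ)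

lemma integrableOn_rpow_mul_ofReal_caputoExp {ν t : ℝ} (h0 : 0 < ν) (h2 : ν < 1 / 2)
    (ht : 0 < t) :
    IntegrableOn (fun r => ((r ^ (-ν) : ℝ) : ℂ) * (caputoExp ν t r : ℂ)) (Ioi 0) :=
  (integrableOn_rpow_mul_caputoExp h0 h2 ht).ofReal.congr
    (Eventually.of_forall fun r => by simp)

lemma integrableOn_rpow_mul_exp_term {ν t : ℝ} (ψ : ℝ) (h0 : 0 < ν) (ht : 0 < t) :
    IntegrableOn (fun r => ((r ^ (-ν) : ℝ) : ℂ) * (Complex.exp (ψ * Complex.I) *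
      ((Real.Gamma (1 - 2 * ν) * (r ^ (2 * ν - 1) * Real.exp (-(t * r))) : ℝ) : ℂ))) (Ioi 0) := by
  refine ((integrableOn_rpow_mul_exp_neg_mul (by linarith : -1 < ν - 1) ht).ofReal.const_mul
    (Complex.exp (ψ * Complex.I) * Real.Gamma (1 - 2 * ν))).congr ?_
  filter_upwards [ae_restrict_mem measurableSet_Ioi] with r hr
  have hr : 0 < r := hr
  have e : r ^ (ν - 1) = r ^ (-ν) * r ^ (2 * ν - 1) := by
    rw [← Real.rpow_add hr]; ring_nf
  change _ * ((r ^ (ν - 1) * Real.exp (-(t * r)) : ℝ) : ℂ) = _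
  rw [e]
  push_cast
  ring

lemma integrableOn_rpow_mul_caputoDefect {ν t : ℝ} (ψ : ℝ) (h0 : 0 < ν) (h2 : ν < 1 / 2)
    (ht : 0 < t) :
    IntegrableOn (fun r => ((r ^ (-ν) : ℝ) : ℂ) * caputoDefect ν ψ t r) (Ioi 0) := by
  simp only [caputoDefect, mul_sub]
  exact (integrableOn_rpow_mul_ofReal_caputoExp h0 h2 ht).sub
    (integrableOn_rpow_mul_exp_term ψ h0 ht)

lemma sin_pi_mul_Gamma_mul_Gamma {w : ℂ} (h0 : 0 < w.re) (h1 : w.re < 1) :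
    Complex.sin (Real.pi * w) * (Complex.Gamma w * Complex.Gamma (1 - w)) = Real.pi := by
  have h := Complex.Gamma_mul_Gamma_one_sub w
  have hne : Complex.Gamma w * Complex.Gamma (1 - w) ≠ 0 :=
    mul_ne_zero (Complex.Gamma_ne_zero_of_re_pos h0)
      (Complex.Gamma_ne_zero_of_re_pos (by simpa using h1))
  have hsin : Complex.sin (Real.pi * w) ≠ 0 := fun h' => hne (by rw [h, h', div_zero])
  rw [h, mul_div_cancel₀ _ hsin]

lemma integral_cpow_mul_caputoDefect {ν t : ℝ} {s : ℂ} (ψ : ℝ) (h0 : 0 < ν) (h2 : ν < 1 / 2)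
    (ht : 0 < t) (hs : s.re = 1) :
    ∫ r in Ioi (0 : ℝ), (r : ℂ) ^ (-(ν * s)) * caputoDefect ν ψ t r =
      (t : ℂ) ^ (ν * s - 2 * ν) * Complex.Gamma (1 - 2 * ν) *
        (Complex.Gamma (ν * s) * Complex.Gamma (1 - ν * s) /
            Complex.Gamma (ν * s + (1 - 2 * ν)) -
          Complex.exp (ψ * Complex.I) * Complex.Gamma (2 * ν - ν * s)) := by
  simp only [caputoDefect, mul_sub]
  rw [integral_sub
    (integrableOn_cpow_mul hs (integrableOn_rpow_mul_ofReal_caputoExp h0 h2 ht))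
    (integrableOn_cpow_mul hs (integrableOn_rpow_mul_exp_term ψ h0 ht)),
    integral_cpow_mul_caputoExp h0 h2 ht hs]
  have e : ∀ r : ℝ, (r : ℂ) ^ (-(ν * s)) * (Complex.exp (ψ * Complex.I) *
      ((Real.Gamma (1 - 2 * ν) * (r ^ (2 * ν - 1) * Real.exp (-(t * r))) : ℝ) : ℂ)) =
      (Complex.exp (ψ * Complex.I) * Complex.Gamma (1 - 2 * ν)) * ((r : ℂ) ^ (-(ν * s)) *
        ((r ^ (2 * ν - 1) * Real.exp (-(t * r)) : ℝ) : ℂ)) := fun r => by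
    rw [Complex.ofReal_mul, ← Complex.Gamma_ofReal]
    push_cast
    ring
  simp only [e]
  rw [integral_const_mul, integral_cpow_mul_rpow_mul_exp h0 ht hs]
  ring

lemma mellin_expRpowTransform_caputoDefect_sub {ν t : ℝ} {s : ℂ} (h0 : 0 < ν) (h2 : ν < 1 / 2)
    (ht : 0 < t) (hs : s.re = 1) :
    mellin (expRpowTransform ν (-(Real.pi * ν))
        (caputoDefect ν (Real.pi * (1 - 2 * ν)) t)) s =
      mellin (expRpowTransform ν (Real.pi * ν)
        (caputoDefect ν (-(Real.pi * (1 - 2 * ν))) t)) s := by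
  have hpi := Real.pi_pos
  have hθ : |Real.pi * ν| < Real.pi / 2 := by
    rw [abs_of_pos (mul_pos hpi h0)]; nlinarith
  rw [mellin_expRpowTransform hs (by rwa [abs_neg])
      (integrableOn_rpow_mul_caputoDefect _ h0 h2 ht),
    mellin_expRpowTransform hs hθ (integrableOn_rpow_mul_caputoDefect _ h0 h2 ht),
    integral_cpow_mul_caputoDefect _ h0 h2 ht hs, integral_cpow_mul_caputoDefect _ h0 h2 ht hs]
  set w : ℂ := ν * s with hw
  have hwre : w.re = ν := by simp [hw, hs]
  set w' : ℂ := w + (1 - 2 * ν) with hw'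
  have hw're : w'.re = 1 - ν := by
    simp [hw', hwre]; ring
  have r1 := sin_pi_mul_Gamma_mul_Gamma (w := w) (by linarith) (by linarith)
  have r2 := sin_pi_mul_Gamma_mul_Gamma (w := w') (by linarith) (by linarith)
  have e1 : 1 - w' = 2 * ν - w := by rw [hw']; ring
  rw [e1] at r2
  have hG : Complex.Gamma w' ≠ 0 := Complex.Gamma_ne_zero_of_re_pos (by linarith)
  have a1 : Complex.exp (-(((-(Real.pi * ν) : ℝ) : ℂ) * Complex.I * s)) =
      Complex.exp (Real.pi * w * Complex.I) := by
    congr 1; rw [hw]; push_cast; ring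
  have a2 : Complex.exp (-(((Real.pi * ν : ℝ) : ℂ) * Complex.I * s)) =
      Complex.exp (-(Real.pi * w) * Complex.I) := by
    congr 1; rw [hw]; push_cast; ring
  have b1 : Complex.exp (Real.pi * w * Complex.I) *
      Complex.exp (((Real.pi * (1 - 2 * ν) : ℝ) : ℂ) * Complex.I) =
      Complex.exp (Real.pi * w' * Complex.I) := by
    rw [← Complex.exp_add]; congr 1; rw [hw']; push_cast; ring
  have b2 : Complex.exp (-(Real.pi * w) * Complex.I) *
      Complex.exp (((-(Real.pi * (1 - 2 * ν)) : ℝ) : ℂ) * Complex.I) =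
      Complex.exp (-(Real.pi * w') * Complex.I) := by
    rw [← Complex.exp_add]; congr 1; rw [hw']; push_cast; ring
  have s1 : Complex.exp (Real.pi * w * Complex.I) - Complex.exp (-(Real.pi * w) * Complex.I) =
      2 * Complex.I * Complex.sin (Real.pi * w) := by
    rw [Complex.exp_mul_I, Complex.exp_mul_I, Complex.cos_neg, Complex.sin_neg]; ring
  have s2 : Complex.exp (Real.pi * w' * Complex.I) - Complex.exp (-(Real.pi * w') * Complex.I) =
      2 * Complex.I * Complex.sin (Real.pi * w') := by
    rw [Complex.exp_mul_I, Complex.exp_mul_I, Complex.cos_neg, Complex.sin_neg]; ring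
  rw [a1, a2]
  have key : (Complex.exp (Real.pi * w * Complex.I) - Complex.exp (-(Real.pi * w) * Complex.I)) *
      (Complex.Gamma w * Complex.Gamma (1 - w) / Complex.Gamma w') =
      (Complex.exp (Real.pi * w' * Complex.I) - Complex.exp (-(Real.pi * w') * Complex.I)) *
        Complex.Gamma (2 * ν - w) := by
    rw [s1, s2, mul_div_assoc', div_eq_iff hG]
    linear_combination 2 * Complex.I * (r1 - r2)
  linear_combination (Complex.Gamma s * (t : ℂ) ^ (w - 2 * ν) * Complex.Gamma (1 - 2 * ν)) *
    (key - Complex.Gamma (2 * ν - w) * b1 + Complex.Gamma (2 * ν - w) * b2)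

lemma eq_zero_of_mellin_eq_zero {f : ℝ → ℂ} {x : ℝ} (hx : 0 < x)
    (hf : MellinConvergent f ((1 : ℝ) : ℂ)) (hfx : ContinuousAt f x)
    (h : ∀ s : ℂ, s.re = 1 → mellin f s = 0) : f x = 0 := by
  have hz : ∀ y : ℝ, mellin f (((1 : ℝ) : ℂ) + y * Complex.I) = 0 := fun y => h _ (by simp)
  rw [← mellinInv_mellin_eq 1 f hx hf _ hfx]
  · simp only [mellinInv, hz, smul_zero, integral_zero]
  · simp only [Complex.VerticalIntegrable, hz]
    exact integrable_zero _ _ _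

lemma expRpowTransform_caputoDefect_eq {ν t x : ℝ} (h0 : 0 < ν) (h2 : ν < 1 / 2)
    (ht : 0 < t) (hx : 0 < x) :
    expRpowTransform ν (-(Real.pi * ν)) (caputoDefect ν (Real.pi * (1 - 2 * ν)) t) x =
      expRpowTransform ν (Real.pi * ν) (caputoDefect ν (-(Real.pi * (1 - 2 * ν))) t) x := by
  have hpi := Real.pi_pos
  have hc : 0 < Real.cos (Real.pi * ν) :=
    Real.cos_pos_of_mem_Ioo ⟨by nlinarith, by nlinarith⟩
  have hc' : 0 < Real.cos (-(Real.pi * ν)) := by rwa [Real.cos_neg]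
  have i1 := integrableOn_rpow_mul_caputoDefect (Real.pi * (1 - 2 * ν)) h0 h2 ht
  have i2 := integrableOn_rpow_mul_caputoDefect (-(Real.pi * (1 - 2 * ν))) h0 h2 ht
  have hm : ∀ s : ℂ, s.re = 1 → HasMellin (fun y =>
      expRpowTransform ν (-(Real.pi * ν)) (caputoDefect ν (Real.pi * (1 - 2 * ν)) t) y -
      expRpowTransform ν (Real.pi * ν) (caputoDefect ν (-(Real.pi * (1 - 2 * ν))) t) y) s
      (mellin (expRpowTransform ν (-(Real.pi * ν)) (caputoDefect ν (Real.pi * (1 - 2 * ν)) t)) s -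
      mellin (expRpowTransform ν (Real.pi * ν) (caputoDefect ν (-(Real.pi * (1 - 2 * ν))) t)) s) :=
    fun s hs => hasMellin_sub (mellinConvergent_expRpowTransform hs hc' i1)
      (mellinConvergent_expRpowTransform hs hc i2)
  refine sub_eq_zero.1 (eq_zero_of_mellin_eq_zero hx (hm _ (by simp)).1
    ((continuousAt_expRpowTransform hx hc' i1).sub (continuousAt_expRpowTransform hx hc i2))
    fun s hs => ?_)
  rw [(hm s hs).2, mellin_expRpowTransform_caputoDefect_sub h0 h2 ht hs, sub_self]

lemma conj_expRpowTransform_caputoDefect (ν θ ψ t x : ℝ) :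
    expRpowTransform ν (-θ) (caputoDefect ν (-ψ) t) x =
      (starRingEnd ℂ) (expRpowTransform ν θ (caputoDefect ν ψ t) x) := by
  simp only [expRpowTransform, ← integral_conj, caputoDefect, map_mul, map_sub, ← Complex.exp_conj,
    Complex.conj_ofReal, Complex.conj_I]
  simp

lemma integral_im_mul_caputoExp {ν t x : ℝ} (h0 : 0 < ν) (h2 : ν < 1 / 2)
    (ht : 0 < t) (hx : 0 < x) :
    ∫ r in Ioi (0 : ℝ), (Complex.exp ((-(x * r ^ ν) : ℝ) *
        Complex.exp ((-(Real.pi * ν) : ℝ) * Complex.I))).im * caputoExp ν t r =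
      Real.Gamma (1 - 2 * ν) * ∫ r in Ioi (0 : ℝ), r ^ (2 * ν - 1) * Real.exp (-(t * r)) *
        (Complex.exp ((Real.pi * (1 - 2 * ν) : ℝ) * Complex.I) *
          Complex.exp ((-(x * r ^ ν) : ℝ) *
            Complex.exp ((-(Real.pi * ν) : ℝ) * Complex.I))).im := by
  have hpi := Real.pi_pos
  have hc : 0 < Real.cos (-(Real.pi * ν)) :=
    Real.cos_pos_of_mem_Ioo ⟨by nlinarith, by nlinarith⟩
  have h := expRpowTransform_caputoDefect_eq h0 h2 ht hx
  have hconj := conj_expRpowTransform_caputoDefect ν (-(Real.pi * ν)) (Real.pi * (1 - 2 * ν)) t x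
  rw [neg_neg, ← h] at hconj
  have him := Complex.conj_eq_iff_im.1 hconj.symm
  have i1 := integrableOn_exp_rpow_mul hx hc (integrableOn_rpow_mul_ofReal_caputoExp h0 h2 ht)
  have i2 := integrableOn_exp_rpow_mul hx hc
    (integrableOn_rpow_mul_exp_term (Real.pi * (1 - 2 * ν)) h0 ht)
  generalize Real.pi * (1 - 2 * ν) = ψ at him i2 ⊢
  simp only [expRpowTransform, caputoDefect, mul_sub] at him
  rw [integral_sub i1 i2, Complex.sub_im, sub_eq_zero] at him
  have j1 := integral_im i1
  have j2 := integral_im i2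
  simp only [RCLike.im_to_complex] at j1 j2
  rw [← j1, ← j2] at him
  simp only [Complex.im_mul_ofReal] at him
  rw [him, ← integral_const_mul]
  refine integral_congr_ae (Eventually.of_forall fun r => ?_)
  dsimp only
  rw [← mul_assoc, Complex.im_mul_ofReal, mul_comm (Complex.exp _) (Complex.exp _)]
  ring

lemma integral_rpow_mul_wrightF {ν t x : ℝ} (h0 : 0 < ν) (h2 : ν < 1 / 2)
    (ht : 0 < t) (hx : 0 < x) :
    ∫ τ in Ioo (0 : ℝ) t, (t - τ) ^ (-(2 * ν)) *
        (τ ^ (-1 : ℝ) * wrightF (-(x * τ ^ (-ν))) (-ν) 0) =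
      Real.Gamma (1 - 2 * ν) *
        (t ^ (-(2 * ν)) * wrightF (-(x * t ^ (-ν))) (-ν) (1 - 2 * ν)) := by
  have hpi := Real.pi_pos
  have hc : 0 < Real.cos (-(Real.pi * ν)) :=
    Real.cos_pos_of_mem_Ioo ⟨by nlinarith, by nlinarith⟩
  set Φ : ℝ → ℂ := fun r => Complex.exp ((-(x * r ^ ν) : ℝ) *
        Complex.exp ((-(Real.pi * ν) : ℝ) * Complex.I)) with hΦ
  have hΦm : Measurable Φ := (measurable_exp_rpow ν _).comp measurable_prodMk_left
  have hR := rpow_mul_wrightF_eq_integral (β := 1 - 2 * ν) x h0 (by linarith) (by linarith) ht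
  have hL : ∀ τ ∈ Ioo (0 : ℝ) t, (t - τ) ^ (-(2 * ν)) *
      (τ ^ (-1 : ℝ) * wrightF (-(x * τ ^ (-ν))) (-ν) 0) =
      (1 / Real.pi) * ∫ r in Ioi (0 : ℝ),
        (Φ r).im * ((t - τ) ^ (-(2 * ν)) * Real.exp (-(τ * r))) := fun τ hτ => by
    have h := rpow_mul_wrightF_eq_integral (β := 0) x h0 (by linarith) one_pos hτ.1
    simp only [zero_sub, neg_zero, Real.rpow_zero, one_mul, mul_zero, Complex.ofReal_zero,
      zero_mul, Complex.exp_zero] at h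
    rw [h, mul_left_comm, ← integral_const_mul]
    congr 1
    refine integral_congr_ae (Eventually.of_forall fun r => ?_)
    simp only [hΦ]
    ring
  have hI : Integrable (Function.uncurry fun r τ : ℝ =>
      (Φ r).im * ((t - τ) ^ (-(2 * ν)) * Real.exp (-(τ * r))))
      ((volume.restrict (Ioi 0)).prod (volume.restrict (Ioo 0 t))) := by
    refine Integrable.mono ((integrable_caputo_kernel h0 h2 ht).const_mul
      (x * Real.cos (-(Real.pi * ν)))⁻¹) ?_ ?_
    · refine Measurable.aestronglyMeasurable ?_
      exact ((Complex.measurable_im.comp hΦm).comp measurable_fst).mul (by fun_prop)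
    · have hae : ∀ᵐ p ∂((volume.restrict (Ioi (0 : ℝ))).prod (volume.restrict (Ioo 0 t))),
          p ∈ Ioi (0 : ℝ) ×ˢ Ioo 0 t := by
        rw [Measure.prod_restrict]
        exact ae_restrict_mem (measurableSet_Ioi.prod measurableSet_Ioo)
      filter_upwards [hae] with p hp
      have hp1 : 0 < p.1 := hp.1
      simp only [Function.uncurry]
      rw [← mul_assoc (x * Real.cos (-(Real.pi * ν)))⁻¹, norm_mul,
        norm_mul _ ((t - p.2) ^ (-(2 * ν)) * Real.exp (-(p.2 * p.1)))]
      refine mul_le_mul_of_nonneg_right ?_ (norm_nonneg _)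
      have hnn : 0 ≤ (x * Real.cos (-(Real.pi * ν)))⁻¹ * p.1 ^ (-ν) :=
        mul_nonneg (inv_nonneg.2 (mul_pos hx hc).le) (Real.rpow_nonneg hp1.le _)
      rw [Real.norm_of_nonneg hnn, Real.norm_eq_abs]
      refine (Complex.abs_im_le_norm _).trans ?_
      simp only [hΦ, norm_exp_ofReal_mul_exp]
      exact exp_neg_rpow_le hx hp1 hc
  rw [setIntegral_congr_fun measurableSet_Ioo hL, integral_const_mul,
    ← integral_integral_swap hI]
  simp only [integral_const_mul]
  have hmain := integral_im_mul_caputoExp h0 h2 ht hx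
  simp only [caputoExp] at hmain
  rw [hmain]
  have e1 : -(1 - 2 * ν) = 2 * ν - 1 := by ring
  have e2 : 1 - 2 * ν - 1 = -(2 * ν) := by ring
  rw [e1, e2] at hR
  rw [hR]
  ring

lemma hasDerivAt_wrightF_mul_rpow_neg {ν x τ : ℝ} (h0 : 0 < ν) (h1 : ν < 1) (hτ : 0 < τ) :
    HasDerivAt (fun τ => wrightF (-(x * τ ^ (-ν))) (-ν) 1)
      (τ ^ (-1 : ℝ) * wrightF (-(x * τ ^ (-ν))) (-ν) 0) τ := by
  have hz : HasDerivAt (fun τ : ℝ => -(x * τ ^ (-ν))) (-(x * (-ν * τ ^ (-ν - 1)))) τ :=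
    ((Real.hasDerivAt_rpow_const (Or.inl hτ.ne')).const_mul x).neg
  have h := (hasDerivAt_wrightF (β := 1) (-(x * τ ^ (-ν))) h0 h1 (by linarith)).comp τ hz
  refine h.congr_deriv ?_
  rw [← mul_wrightF_one_sub _ h0 h1, sub_eq_add_neg (-ν), Real.rpow_add hτ]
  ring

lemma hasDerivAt_wrightF_mul_const {ν β : ℝ} (c x : ℝ) (h0 : 0 < ν) (h1 : ν < 1)
    (hβ : β < 1 + ν) :
    HasDerivAt (fun x => wrightF (-(x * c)) (-ν) β)
      (-(c * wrightF (-(x * c)) (-ν) (β - ν))) x := by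
  have hz : HasDerivAt (fun x : ℝ => -(x * c)) (-(1 * c)) x := ((hasDerivAt_id x).mul_const c).neg
  refine ((hasDerivAt_wrightF (-(x * c)) h0 h1 hβ).comp x hz).congr_deriv ?_
  ring

lemma caputoD_uWright {α x t : ℝ} (B C : ℝ) (hα0 : 0 < α) (hα1 : α < 1) (ht : 0 < t)
    (hx : 0 < x) :
    caputoD α (fun t' => uWright α B C x t') t =
      -((C - B) / (1 - wrightF (-1) (-(α / 2)) 1) *
        (t ^ (-α) * wrightF (-(x * t ^ (-(α / 2)))) (-(α / 2)) (1 - α))) := by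
  have h0 : 0 < α / 2 := by linarith
  have hα : 2 * (α / 2) = α := by ring
  have hcap := integral_rpow_mul_wrightF h0 (by linarith) ht hx
  rw [hα] at hcap
  have hΓ : Real.Gamma (1 - α) ≠ 0 := (Real.Gamma_pos_of_pos (by linarith)).ne'
  have hd : ∀ τ ∈ Ioo 0 t, (t - τ) ^ (-α) * deriv (fun t' => uWright α B C x t') τ =
      -((C - B) / (1 - wrightF (-1) (-(α / 2)) 1)) * ((t - τ) ^ (-α) *
        (τ ^ (-1 : ℝ) * wrightF (-(x * τ ^ (-(α / 2)))) (-(α / 2)) 0)) := fun τ hτ => by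
    have h := (((hasDerivAt_wrightF_mul_rpow_neg (x := x) h0 (by linarith) hτ.1).const_sub 1).const_mul
      ((C - B) / (1 - wrightF (-1) (-(α / 2)) 1))).const_add B
    have h' : deriv (fun t' => uWright α B C x t') τ = _ := h.deriv
    rw [h']
    ring
  rw [caputoD, intervalIntegral.integral_of_le ht.le, integral_Ioc_eq_integral_Ioo,
    setIntegral_congr_fun measurableSet_Ioo hd, integral_const_mul, hcap]
  field_simp

lemma deriv_deriv_uWright {α t : ℝ} (B C x : ℝ) (hα0 : 0 < α) (hα1 : α < 1) (ht : 0 < t) :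
    deriv (deriv fun x' => uWright α B C x' t) x =
      -((C - B) / (1 - wrightF (-1) (-(α / 2)) 1) *
        (t ^ (-α) * wrightF (-(x * t ^ (-(α / 2)))) (-(α / 2)) (1 - α))) := by
  have h0 : 0 < α / 2 := by linarith
  have h1 : α / 2 < 1 := by linarith
  have hd : (deriv fun x' => uWright α B C x' t) = fun x' =>
      (C - B) / (1 - wrightF (-1) (-(α / 2)) 1) *
        (t ^ (-(α / 2)) * wrightF (-(x' * t ^ (-(α / 2)))) (-(α / 2)) (1 - α / 2)) := by
    funext x'
    have h := (((hasDerivAt_wrightF_mul_const (β := 1) (t ^ (-(α / 2))) x' h0 h1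
      (by linarith)).const_sub 1).const_mul
        ((C - B) / (1 - wrightF (-1) (-(α / 2)) 1))).const_add B
    have h' : deriv (fun x' => uWright α B C x' t) x' = _ := h.deriv
    rw [h', neg_neg]
  have h := ((hasDerivAt_wrightF_mul_const (β := 1 - α / 2) (t ^ (-(α / 2))) x h0 h1
    (by linarith)).const_mul (t ^ (-(α / 2)))).const_mul
      ((C - B) / (1 - wrightF (-1) (-(α / 2)) 1))
  have e1 : 1 - α / 2 - α / 2 = 1 - α := by ring
  have e2 : t ^ (-α) = t ^ (-(α / 2)) * t ^ (-(α / 2)) := by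
    rw [← Real.rpow_add ht]; ring_nf
  rw [hd, h.deriv, e1, e2]
  ring

/-- The function `u(x,t) = B + (C-B)/(1-W(-1;-α/2;1)) [1 - W(-x t^(-α/2);-α/2;1)]`
solves the fractional diffusion equation `D^α_t u = u_xx` for `0 < x < t^(α/2)`,
`0 < t ≤ T`, with boundary conditions `u(0,t) = B` and `u(t^(α/2),t) = C`. -/
theorem uWright_solves_FDE (α B C T : ℝ) (hα0 : 0 < α) (hα1 : α < 1) (hT : 0 < T)
    (hW : wrightF (-1) (-(α / 2)) 1 ≠ 1) :
    ∀ t ∈ Set.Ioc (0:ℝ) T,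
      (∀ x ∈ Set.Ioo (0:ℝ) (t ^ (α / 2)),
        caputoD α (fun t' => uWright α B C x t') t
          = deriv (deriv fun x' => uWright α B C x' t) x) ∧
      uWright α B C 0 t = B ∧
      uWright α B C (t ^ (α / 2)) t = C := by
  intro t ht
  refine ⟨fun x hx => ?_, ?_, ?_⟩
  · rw [caputoD_uWright B C hα0 hα1 ht.1 hx.1, deriv_deriv_uWright B C x hα0 hα1 ht.1]
  · simp [uWright, wrightF_zero]
  · have e : t ^ (α / 2) * t ^ (-(α / 2)) = 1 := by
      rw [← Real.rpow_add ht.1, add_neg_cancel, Real.rpow_zero]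
    have hne : 1 - wrightF (-1) (-(α / 2)) 1 ≠ 0 := sub_ne_zero.2 hW.symm
    rw [uWright, e, div_mul_cancel₀ _ hne]
    ring
end
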